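/- arXiv:1707.07288 — 2 statements merged into one kernel-verified Lean document; each statement's English description precedes it below -/
import Mathlib

section
/- For every even integer ν ≥ 14: every 2-extendable non-bipartite finite simple graph on ν vertices has at least 3ν/2 edges, and there exists a 3-regular 2-extendable non-bipartite finite simple graph on ν vertices (hence one with exactly 3ν/2 edges). Therefore ε(ν,2) = 3ν/2 for all even ν ≥ 14. -/
open SimpleGraph

/-- `G` is `n`-factor-critical if for every set `S` of exactly `n` vertices,
the graph obtained by deleting `S` has a perfect matching; formalized as:
there is a matching of `G` whose vertex set is exactly the complement of `S`. -/
def IsFactorCritical {V : Type*} (G : SimpleGraph V) (n : ℕ) : Prop :=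
  ∀ S : Finset V, S.card = n →
    ∃ M : G.Subgraph, M.IsMatching ∧ M.verts = (↑S : Set V)ᶜ

/-- `G` is `k`-extendable if it is connected, has a matching with `k` edges,
and every matching with `k` edges is contained in a perfect matching. -/
def IsExtendable {V : Type*} (G : SimpleGraph V) (k : ℕ) : Prop :=
  G.Connected ∧
  (∃ M : G.Subgraph, M.IsMatching ∧ M.edgeSet.ncard = k) ∧
  ∀ M : G.Subgraph, M.IsMatching → M.edgeSet.ncard = k →
    ∃ P : G.Subgraph, P.IsPerfectMatching ∧ M ≤ P

namespace SimpleGraph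

variable {V : Type*} {G : SimpleGraph V}

/-- A perfect matching of `G`, presented as the involution that sends each vertex to its mate. -/
structure IsMate (G : SimpleGraph V) (f : V → V) : Prop where
  adj : ∀ v, G.Adj v (f v)
  invol : ∀ v, f (f v) = v

/-- The matching with the two edges `ab` and `cd`. -/
def pairMatching {a b c d : V} (hab : G.Adj a b) (hcd : G.Adj c d) : G.Subgraph :=
  G.subgraphOfAdj hab ⊔ G.subgraphOfAdj hcd

lemma isMatching_pairMatching {a b c d : V} (hab : G.Adj a b) (hcd : G.Adj c d)
    (hac : a ≠ c) (had : a ≠ d) (hbc : b ≠ c) (hbd : b ≠ d) :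
    (pairMatching hab hcd).IsMatching := by
  refine Subgraph.IsMatching.sup (.subgraphOfAdj hab) (.subgraphOfAdj hcd) ?_
  simp [support_subgraphOfAdj, hac.symm, had.symm, hbc.symm, hbd.symm]

lemma ncard_edgeSet_pairMatching {a b c d : V} (hab : G.Adj a b) (hcd : G.Adj c d)
    (hac : a ≠ c) (had : a ≠ d) : (pairMatching hab hcd).edgeSet.ncard = 2 := by
  simp only [pairMatching, Subgraph.edgeSet_sup, edgeSet_subgraphOfAdj, Set.singleton_union]
  exact Set.ncard_pair (by simp [hac, had])

/-- A perfect matching as an involution and as a subgraph. -/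
lemma exists_isMate_of_isPerfectMatching {P : G.Subgraph} (hP : P.IsPerfectMatching) :
    ∃ f, G.IsMate f ∧ ∀ v w, P.Adj v w → f v = w := by
  choose f hf huniq using fun v => hP.1 (hP.2 v)
  exact ⟨f, ⟨fun v => (hf v).adj_sub, fun v => (huniq _ _ (hf v).symm).symm⟩,
    fun v w h => (huniq v w h).symm⟩

lemma exists_isMate_of_isExtendable (h : IsExtendable G 2) : ∃ f, G.IsMate f := by
  obtain ⟨-, ⟨M, hM, hcard⟩, hext⟩ := h
  obtain ⟨P, hP, -⟩ := hext M hM hcard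
  obtain ⟨f, hf, -⟩ := exists_isMate_of_isPerfectMatching hP
  exact ⟨f, hf⟩

lemma exists_isMate_of_isExtendable_two (h : IsExtendable G 2) {a b c d : V}
    (hab : G.Adj a b) (hcd : G.Adj c d)
    (hac : a ≠ c) (had : a ≠ d) (hbc : b ≠ c) (hbd : b ≠ d) :
    ∃ f, G.IsMate f ∧ f a = b ∧ f c = d := by
  obtain ⟨P, hP, hle⟩ := h.2.2 _ (isMatching_pairMatching hab hcd hac had hbc hbd)
    (ncard_edgeSet_pairMatching hab hcd hac had)
  obtain ⟨f, hf, hfP⟩ := exists_isMate_of_isPerfectMatching hP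
  exact ⟨f, hf, hfP _ _ (hle.2 (by simp [pairMatching])),
    hfP _ _ (hle.2 (by simp [pairMatching]))⟩

/-- `2`-extendability in terms of mate involutions. -/
def PairExtends (G : SimpleGraph V) : Prop :=
  ∀ a b c d, G.Adj a b → G.Adj c d → a ≠ c → a ≠ d → b ≠ c → b ≠ d →
    ∃ f, G.IsMate f ∧ f a = b ∧ f c = d

lemma IsMate.isPerfectMatching {f : V → V} (hf : G.IsMate f) :
    ∃ P : G.Subgraph, P.IsPerfectMatching ∧ P.verts = Set.univ ∧
      ∀ v w, P.Adj v w ↔ f v = w := by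
  refine ⟨⟨Set.univ, fun v w => f v = w, ?_, ?_, ?_⟩, ⟨?_, ?_⟩, rfl, fun _ _ => Iff.rfl⟩
  · rintro v _ rfl
    exact hf.adj v
  · intros
    trivial
  · constructor
    rintro v _ rfl
    exact hf.invol v
  · intro v _
    exact ⟨f v, rfl, fun _ h => Eq.symm h⟩
  · intro v
    trivial

lemma PairExtends.isExtendable (h : G.PairExtends) (hconn : G.Connected)
    {a b c d : V} (hab : G.Adj a b) (hcd : G.Adj c d)
    (hac : a ≠ c) (had : a ≠ d) (hbc : b ≠ c) (hbd : b ≠ d) : IsExtendable G 2 := by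
  refine ⟨hconn, ⟨_, isMatching_pairMatching hab hcd hac had hbc hbd,
    ncard_edgeSet_pairMatching hab hcd hac had⟩, fun M hM hcard => ?_⟩
  obtain ⟨e, e', hne, he⟩ := Set.ncard_eq_two.mp hcard
  induction e with | _ x y
  induction e' with | _ z w
  have hxy : M.Adj x y := by simp [← Subgraph.mem_edgeSet, he]
  have hzw : M.Adj z w := by simp [← Subgraph.mem_edgeSet, he]
  have hxz : x ≠ z := by
    rintro rfl
    exact hne (by rw [hM.eq_of_adj_left hxy hzw])
  have hxw : x ≠ w := by
    rintro rfl
    exact hne (by rw [hM.eq_of_adj_left hxy hzw.symm, Sym2.eq_swap])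
  have hyz : y ≠ z := by
    rintro rfl
    exact hne (by rw [hM.eq_of_adj_left hxy.symm hzw, Sym2.eq_swap])
  have hyw : y ≠ w := by
    rintro rfl
    exact hne (by rw [hM.eq_of_adj_left hxy.symm hzw.symm])
  obtain ⟨f, hf, rfl, rfl⟩ := h _ _ _ _ hxy.adj_sub hzw.adj_sub hxz hxw hyz hyw
  obtain ⟨P, hP, hverts, hadj⟩ := hf.isPerfectMatching
  refine ⟨P, hP, by simp [hverts], fun v u hvu => ?_⟩
  have hmem := Subgraph.mem_edgeSet.mpr hvu
  rw [hadj]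
  simp only [he, Set.mem_insert_iff, Set.mem_singleton_iff, Sym2.eq_iff] at hmem
  rcases hmem with (⟨rfl, rfl⟩ | ⟨rfl, rfl⟩) | ⟨rfl, rfl⟩ | ⟨rfl, rfl⟩ <;> simp [hf.invol]

lemma not_colorable_two_of_five_cycle {p q r s t : V} (hpq : G.Adj p q) (hqr : G.Adj q r)
    (hrs : G.Adj r s) (hst : G.Adj s t) (htp : G.Adj t p) : ¬ G.Colorable 2 := by
  rintro ⟨C⟩
  have h1 := C.valid hpq
  have h2 := C.valid hqr
  have h3 := C.valid hrs
  have h4 := C.valid hst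
  have h5 := C.valid htp
  omega

lemma two_mul_ncard_edgeSet [Fintype V] :
    2 * G.edgeSet.ncard = ∑ v, (G.neighborSet v).ncard := by
  classical
  rw [← coe_edgeFinset, Set.ncard_coe_finset, ← sum_degrees_eq_twice_card_edges]
  refine Finset.sum_congr rfl fun v _ => ?_
  rw [← card_neighborSet_eq_degree, Set.ncard_eq_toFinset_card', Set.toFinset_card]

/-- In a connected graph, a proper nonempty set of vertices is left by some edge. -/
lemma Connected.exists_adj_mem_notMem (h : G.Connected) {S : Set V} {v w : V} (hv : v ∈ S)
    (hw : w ∉ S) : ∃ x ∈ S, ∃ y ∉ S, G.Adj x y := by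
  obtain ⟨p⟩ := h.preconnected v w
  obtain ⟨d, -, h1, h2⟩ := p.exists_boundary_dart S hv hw
  exact ⟨_, h1, _, h2, d.adj⟩

section LowerBound

variable [Fintype V]

lemma exists_notMem_of_card_lt {W : Finset V} (h : W.card < Fintype.card V) : ∃ x, x ∉ W := by
  by_contra! hW
  exact h.not_ge (Finset.card_le_card (fun x _ => hW x))

lemma exists_isMate_of_adj (h : IsExtendable G 2) (hcard : 5 ≤ Fintype.card V) {p q : V}
    (hpq : G.Adj p q) : ∃ f, G.IsMate f ∧ f p = q := by
  classical
  obtain ⟨f, hf⟩ := exists_isMate_of_isExtendable h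
  obtain ⟨x, hx⟩ := exists_notMem_of_card_lt (W := {p, q, f p, f q})
    (lt_of_le_of_lt Finset.card_le_four hcard)
  simp only [Finset.mem_insert, Finset.mem_singleton, not_or] at hx
  obtain ⟨h1, h2, h3, h4⟩ := hx
  have h5 : p ≠ f x := fun h => h3 (by rw [h, hf.invol])
  have h6 : q ≠ f x := fun h => h4 (by rw [h, hf.invol])
  obtain ⟨g, hg, hg1, -⟩ := exists_isMate_of_isExtendable_two h hpq (hf.adj x) (Ne.symm h1) h5
    (Ne.symm h2) h6
  exact ⟨g, hg, hg1⟩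

lemma exists_neighbor_ne (h : IsExtendable G 2) (hcard : 5 ≤ Fintype.card V) {v a : V}
    (hva : G.Adj v a) : ∃ b, b ≠ a ∧ G.Adj v b := by
  classical
  by_contra! hN
  obtain ⟨w, hw⟩ := exists_notMem_of_card_lt (W := {v, a})
    (lt_of_le_of_lt Finset.card_le_two (by omega))
  obtain ⟨x, hx, y, hy, hxy⟩ := h.1.exists_adj_mem_notMem (S := {v, a}) (v := v) (w := w)
    (by simp) (by simpa using hw)
  simp only [Set.mem_insert_iff, Set.mem_singleton_iff, not_or] at hx hy
  rcases hx with rfl | rfl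
  · exact hN y hy.2 hxy
  · obtain ⟨f, hf, rfl⟩ := exists_isMate_of_adj h hcard hxy
    have : f v = x := by
      by_contra hne
      exact hN _ hne (hf.adj v)
    exact hy.1 (by rw [← this, hf.invol])

lemma three_le_ncard_neighborSet (h : IsExtendable G 2) (hcard : 5 ≤ Fintype.card V) (v : V) :
    3 ≤ (G.neighborSet v).ncard := by
  classical
  by_contra! hlt
  obtain ⟨f, hf⟩ := exists_isMate_of_isExtendable h
  have hva := hf.adj v
  obtain ⟨b, hba, hvb⟩ := exists_neighbor_ne h hcard hva
  set a := f v with ha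
  have hN : ∀ w, G.Adj v w → w = a ∨ w = b := by
    intro w hw
    by_contra! hne
    have hsub : (({a, b, w} : Finset V) : Set V) ⊆ G.neighborSet v := by
      intro x hx
      simp only [Finset.coe_insert, Finset.coe_singleton, Set.mem_insert_iff,
        Set.mem_singleton_iff] at hx
      rcases hx with rfl | rfl | rfl <;> assumption
    have := Set.ncard_le_ncard hsub (Set.toFinite _)
    rw [Set.ncard_coe_finset, Finset.card_eq_three.mpr
      ⟨a, b, w, hba.symm, hne.1.symm, hne.2.symm, rfl⟩] at this
    omega
  -- no perfect matching uses edges covering both `a` and `b` without using `v`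
  have key : ∀ g, G.IsMate g → g a ≠ v → g b ≠ v → False := by
    intro g hg h1 h2
    rcases hN _ (hg.adj v) with h3 | h3
    · exact h1 (by rw [← h3, hg.invol])
    · exact h2 (by rw [← h3, hg.invol])
  have key₂ : ∀ {x y}, G.Adj a x → G.Adj b y → x ≠ v → y ≠ v → x ≠ b → y ≠ a → x ≠ y → False := by
    intro x y hax hby hxv hyv hxb hya hxy
    obtain ⟨g, hg, rfl, rfl⟩ := exists_isMate_of_isExtendable_two h hax hby hba.symm hya.symm
      hxb hxy
    exact key g hg hxv hyv
  have hfb : f b ≠ v := fun h => hba (by rw [ha, ← h, hf.invol])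
  have hfba : f b ≠ a := fun h => hvb.ne (by rw [← hf.invol b, h, ha, hf.invol])
  have hab : ¬ G.Adj a b := by
    intro hab
    obtain ⟨g, hg, hg1⟩ := exists_isMate_of_adj h hcard hab
    refine key g hg (hg1 ▸ hvb.ne') ?_
    rw [← hg1, hg.invol]
    exact hva.ne'
  have hNa : ∀ x, G.Adj a x → x = v ∨ x = f b := by
    intro x hx
    by_contra! hne
    exact key₂ hx (hf.adj b) hne.1 hfb (fun h => hab (h ▸ hx)) hfba hne.2
  obtain ⟨a', ha'v, haa'⟩ := exists_neighbor_ne h hcard hva.symm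
  obtain rfl : a' = f b := (hNa a' haa').resolve_left ha'v
  have hNb : ∀ y, G.Adj b y → y = v ∨ y = f b := by
    intro y hy
    by_contra! hne
    exact key₂ haa' hy hfb hne.1 (hf.adj b).ne' (fun h => hab (h ▸ hy).symm) hne.2.symm
  obtain ⟨w, hw⟩ := exists_notMem_of_card_lt (W := {v, a, b, f b})
    (lt_of_le_of_lt Finset.card_le_four hcard)
  obtain ⟨x, hx, c, hc, hxc⟩ := h.1.exists_adj_mem_notMem (S := {v, a, b, f b}) (v := v) (w := w)
    (by simp) (by simpa using hw)
  simp only [Set.mem_insert_iff, Set.mem_singleton_iff, not_or] at hx hc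
  obtain ⟨hcv, hca, hcb, hcfb⟩ := hc
  rcases hx with rfl | rfl | rfl | rfl
  · exact (hN c hxc).elim hca hcb
  · exact (hNa c hxc).elim hcv hcfb
  · exact (hNb c hxc).elim hcv hcfb
  · obtain ⟨g, hg, rfl⟩ := exists_isMate_of_adj h hcard hxc
    have h1 : g a = v := (hNa _ (hg.adj a)).resolve_right fun h => hca (by rw [← h, hg.invol])
    have h2 : g b = v := (hNb _ (hg.adj b)).resolve_right fun h => hcb (by rw [← h, hg.invol])
    exact hba (by rw [← hg.invol b, h2, ← h1, hg.invol])

end LowerBound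
section Transfer

variable {W : Type*}

lemma PairExtends.comap (h : G.PairExtends) (e : W ≃ V) : (G.comap e).PairExtends := by
  intro a b c d hab hcd hac had hbc hbd
  obtain ⟨f, hf, h1, h2⟩ := h (e a) (e b) (e c) (e d) hab hcd (e.injective.ne hac)
    (e.injective.ne had) (e.injective.ne hbc) (e.injective.ne hbd)
  exact ⟨fun w => e.symm (f (e w)), ⟨fun w => by simpa using hf.adj (e w),
    fun w => by simp [hf.invol]⟩, by simp [h1], by simp [h2]⟩

lemma exists_fin_of_cubic [Fintype V] {ν : ℕ} (hcard : Fintype.card V = ν)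
    (hconn : G.Connected) (hcubic : ∀ v, (G.neighborSet v).ncard = 3) (hext : G.PairExtends)
    {p q r s t : V} (hpq : G.Adj p q) (hqr : G.Adj q r) (hrs : G.Adj r s) (hst : G.Adj s t)
    (htp : G.Adj t p) (hpr : p ≠ r) (hps : p ≠ s) (hqs : q ≠ s) :
    ∃ G' : SimpleGraph (Fin ν), IsExtendable G' 2 ∧ ¬ G'.Colorable 2 ∧
      (∀ v, (G'.neighborSet v).ncard = 3) ∧ G'.edgeSet.ncard = 3 * ν / 2 := by
  let e : Fin ν ≃ V := (Fintype.equivFinOfCardEq hcard).symm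
  have hadj : ∀ {x y}, G.Adj x y → (G.comap e).Adj (e.symm x) (e.symm y) := by simp
  have hcubic' : ∀ v, ((G.comap e).neighborSet v).ncard = 3 := by
    intro v
    rw [← hcubic (e v), ← Set.ncard_image_of_injective _ e.injective]
    congr 1
    ext x
    simp [mem_neighborSet]
  refine ⟨G.comap e, (hext.comap e).isExtendable ((Iso.comap e G).connected_iff.mpr hconn)
    (hadj hpq) (hadj hrs) (by simpa) (by simpa) (by simpa using hqr.ne) (by simpa),
    not_colorable_two_of_five_cycle (hadj hpq) (hadj hqr) (hadj hrs) (hadj hst) (hadj htp),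
    hcubic', ?_⟩
  have h := two_mul_ncard_edgeSet (G := G.comap e)
  simp only [hcubic', Finset.sum_const, Finset.card_univ, Fintype.card_fin, smul_eq_mul] at h
  omega

end Transfer

section Petersen

variable {n : ℕ}

/-- The edges of the generalized Petersen graph `GP(n, 2)`, each with one orientation. -/
inductive PetersenArc (n : ℕ) : ZMod n ⊕ ZMod n → ZMod n ⊕ ZMod n → Prop
  | outer (i : ZMod n) : PetersenArc n (.inl i) (.inl (i + 1))
  | spoke (i : ZMod n) : PetersenArc n (.inl i) (.inr i)
  | inner (i : ZMod n) : PetersenArc n (.inr i) (.inr (i + 2))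

/-- The generalized Petersen graph `GP(n, 2)`. -/
def petersen (n : ℕ) : SimpleGraph (ZMod n ⊕ ZMod n) := fromRel (PetersenArc n)

lemma zmod_natCast_ne_zero {k : ℕ} (h0 : 0 < k) (hk : k < n) : (k : ZMod n) ≠ 0 := by
  rw [Ne, ZMod.natCast_eq_zero_iff]
  exact Nat.not_dvd_of_pos_of_lt h0 hk

lemma petersen_adj_outer (hn : 5 ≤ n) (i : ZMod n) :
    (petersen n).Adj (.inl i) (.inl (i + 1)) := by
  have := zmod_natCast_ne_zero (n := n) (k := 1) (by omega) (by omega)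
  exact ⟨by simpa using this, .inl (.outer i)⟩

lemma petersen_adj_spoke (i : ZMod n) : (petersen n).Adj (.inl i) (.inr i) :=
  ⟨by simp, .inl (.spoke i)⟩

lemma petersen_adj_inner (hn : 5 ≤ n) (i : ZMod n) :
    (petersen n).Adj (.inr i) (.inr (i + 2)) := by
  have := zmod_natCast_ne_zero (n := n) (k := 2) (by omega) (by omega)
  exact ⟨by simpa using this, .inl (.inner i)⟩

lemma petersen_neighborSet_inl (hn : 5 ≤ n) (i : ZMod n) :
    (petersen n).neighborSet (.inl i) = {.inl (i + 1), .inl (i - 1), .inr i} := by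
  ext x
  simp only [mem_neighborSet, Set.mem_insert_iff, Set.mem_singleton_iff]
  constructor
  · rintro ⟨-, h | h⟩
    · cases h <;> simp
    · cases h
      simp
  · rintro (rfl | rfl | rfl)
    · exact petersen_adj_outer hn i
    · simpa using (petersen_adj_outer hn (i - 1)).symm
    · exact petersen_adj_spoke i

lemma petersen_neighborSet_inr (hn : 5 ≤ n) (i : ZMod n) :
    (petersen n).neighborSet (.inr i) = {.inr (i + 2), .inr (i - 2), .inl i} := by
  ext x
  simp only [mem_neighborSet, Set.mem_insert_iff, Set.mem_singleton_iff]
  constructor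
  · rintro ⟨-, h | h⟩
    · cases h
      simp
    · cases h <;> simp
  · rintro (rfl | rfl | rfl)
    · exact petersen_adj_inner hn i
    · simpa using (petersen_adj_inner hn (i - 2)).symm
    · exact (petersen_adj_spoke i).symm

lemma petersen_ncard_neighborSet (hn : 5 ≤ n) (v : ZMod n ⊕ ZMod n) :
    ((petersen n).neighborSet v).ncard = 3 := by
  have h2 := zmod_natCast_ne_zero (n := n) (k := 2) (by omega) (by omega)
  have h4 := zmod_natCast_ne_zero (n := n) (k := 4) (by omega) (by omega)
  rw [Set.ncard_eq_three]
  rcases v with i | i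
  · refine ⟨_, _, _, ?_, by simp, by simp, petersen_neighborSet_inl hn i⟩
    intro h
    apply h2
    push_cast
    linear_combination Sum.inl_injective h
  · refine ⟨_, _, _, ?_, by simp, by simp, petersen_neighborSet_inr hn i⟩
    intro h
    apply h4
    push_cast
    linear_combination Sum.inr_injective h

lemma petersen_connected (hn : 5 ≤ n) : (petersen n).Connected := by
  have : NeZero n := ⟨by omega⟩
  have h : ∀ k : ℕ, (petersen n).Reachable (.inl 0) (.inl (k : ZMod n)) := by
    intro k
    induction k with
    | zero => simp
    | succ k ih =>
      push_cast
      exact ih.trans (petersen_adj_outer hn _).reachable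
  rw [connected_iff_exists_forall_reachable]
  refine ⟨.inl 0, ?_⟩
  rintro (i | i) <;> obtain ⟨k, rfl⟩ := ZMod.natCast_zmod_surjective i
  · exact h k
  · exact (h k).trans (petersen_adj_spoke _).reachable

/-- The outer edges, spokes and inner edges selected by `a`, `b` and `c` form a perfect matching of
`petersen n`. -/
structure IsSelector (a b c : ZMod n → Prop) : Prop where
  outer_outer : ∀ i, a i → ¬ a (i + 1)
  outer_spoke : ∀ i, a i → ¬ b i
  outer_spoke_succ : ∀ i, a i → ¬ b (i + 1)
  outer_cover : ∀ i, b i ∨ a i ∨ a (i - 1)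
  inner_inner : ∀ i, c i → ¬ c (i + 2)
  inner_spoke : ∀ i, c i → ¬ b i
  inner_spoke_succ : ∀ i, c i → ¬ b (i + 2)
  inner_cover : ∀ i, b i ∨ c i ∨ c (i - 2)

lemma IsSelector.exists_isMate {a b c : ZMod n → Prop} (h : IsSelector a b c) (hn : 5 ≤ n) :
    ∃ f, (petersen n).IsMate f ∧ (∀ i, a i → f (.inl i) = .inl (i + 1)) ∧
      (∀ i, b i → f (.inl i) = .inr i) ∧ ∀ i, c i → f (.inr i) = .inr (i + 2) := by
  classical
  refine ⟨Sum.elim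
    (fun i => if b i then .inr i else if a i then .inl (i + 1) else .inl (i - 1))
    (fun i => if b i then .inl i else if c i then .inr (i + 2) else .inr (i - 2)),
    ⟨?_, ?_⟩, ?_, ?_, ?_⟩
  · rintro (i | i) <;> simp only [Sum.elim_inl, Sum.elim_inr] <;> split_ifs
    · exact petersen_adj_spoke i
    · exact petersen_adj_outer hn i
    · simpa using (petersen_adj_outer hn (i - 1)).symm
    · exact (petersen_adj_spoke i).symm
    · exact petersen_adj_inner hn i
    · simpa using (petersen_adj_inner hn (i - 2)).symm
  · rintro (i | i) <;> simp only [Sum.elim_inl, Sum.elim_inr] <;> split_ifs with hb ha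
    · simp [hb]
    · simp [h.outer_outer i ha, h.outer_spoke_succ i ha]
    · have h' := ((h.outer_cover i).resolve_left hb).resolve_left ha
      simp [h', h.outer_spoke _ h']
    · simp [hb]
    · simp [h.inner_inner i ha, h.inner_spoke_succ i ha]
    · have h' := ((h.inner_cover i).resolve_left hb).resolve_left ha
      simp [h', h.inner_spoke _ h']
  · intro i hi
    simp [hi, h.outer_spoke i hi]
  · intro i hi
    simp [hi]
  · intro i hi
    simp [hi, h.inner_spoke i hi]

/-- Blocks of four consecutive columns starting at the elements of `S`, matched without spokes,
with spokes elsewhere. -/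
lemma isSelector_of_sparse {S : Set (ZMod n)}
    (hS : ∀ i ∈ S, i + 1 ∉ S ∧ i + 2 ∉ S ∧ i + 3 ∉ S) :
    IsSelector (fun i => i ∈ S ∨ i - 2 ∈ S)
      (fun i => i ∉ S ∧ i - 1 ∉ S ∧ i - 2 ∉ S ∧ i - 3 ∉ S) (fun i => i ∈ S ∨ i - 1 ∈ S) := by
  have e1 : ∀ i : ZMod n, i + 1 - 1 = i := fun i => by ring
  have e2 : ∀ i : ZMod n, i + 1 - 2 = i - 1 := fun i => by ring
  have e3 : ∀ i : ZMod n, i + 1 - 3 = i - 2 := fun i => by ring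
  have e4 : ∀ i : ZMod n, i + 2 - 1 = i + 1 := fun i => by ring
  have e5 : ∀ i : ZMod n, i + 2 - 2 = i := fun i => by ring
  have e6 : ∀ i : ZMod n, i + 2 - 3 = i - 1 := fun i => by ring
  have e7 : ∀ i : ZMod n, i - 1 - 2 = i - 3 := fun i => by ring
  have e8 : ∀ i : ZMod n, i - 2 - 1 = i - 3 := fun i => by ring
  have e9 : ∀ i : ZMod n, i - 1 + 1 = i := fun i => by ring
  have e10 : ∀ i : ZMod n, i - 1 + 2 = i + 1 := fun i => by ring
  have e11 : ∀ i : ZMod n, i - 1 + 3 = i + 2 := fun i => by ring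
  have e12 : ∀ i : ZMod n, i - 2 + 1 = i - 1 := fun i => by ring
  have e13 : ∀ i : ZMod n, i - 2 + 2 = i := fun i => by ring
  have e14 : ∀ i : ZMod n, i - 2 + 3 = i + 1 := fun i => by ring
  have hS1 := fun i => hS (i - 1)
  have hS2 := fun i => hS (i - 2)
  simp only [e9, e10, e11, e12, e13, e14] at hS1 hS2
  constructor <;> intro i <;> (try simp only [e1, e2, e3, e4, e5, e6, e7, e8]) <;>
    have h1 := hS i <;> have h2 := hS1 i <;> have h3 := hS2 i <;> tauto

/-- Two blocks of four columns, the second one starting `m` columns after the first. -/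
lemma exists_isMate_two_blocks {m : ℕ} (hm : 4 ≤ m) (hmn : m + 4 ≤ n) (s : ZMod n) :
    ∃ f, (petersen n).IsMate f ∧
      (∀ r : ℕ, r = 0 ∨ r = 2 ∨ r = m ∨ r = m + 2 → f (.inl (s + r)) = .inl (s + r + 1)) ∧
      ∀ r : ℕ, r = 0 ∨ r = 1 ∨ r = m ∨ r = m + 1 → f (.inr (s + r)) = .inr (s + r + 2) := by
  have hne : ∀ k : ℕ, 0 < k → k < n → (k : ZMod n) ≠ 0 := fun k => zmod_natCast_ne_zero
  obtain ⟨f, hf, ha, -, hc⟩ := (isSelector_of_sparse (S := {s, s + m}) (by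
    have hlt : ∀ k : ℕ, 0 < k → k < 4 → s + (k : ZMod n) ≠ s ∧ s + (k : ZMod n) ≠ s + m ∧
        s + m + (k : ZMod n) ≠ s ∧ s + m + (k : ZMod n) ≠ s + m := by
      intro k h0 h4
      refine ⟨?_, ?_, ?_, ?_⟩ <;> intro h
      · exact hne k h0 (by omega) (by linear_combination h)
      · refine hne (m - k) (by omega) (by omega) ?_
        rw [Nat.cast_sub (by omega)]
        linear_combination -h
      · refine hne (m + k) (by omega) (by omega) ?_
        push_cast
        linear_combination h
      · exact hne k h0 (by omega) (by linear_combination h)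
    have h1 := hlt 1 (by omega) (by omega)
    have h2 := hlt 2 (by omega) (by omega)
    have h3 := hlt 3 (by omega) (by omega)
    push_cast at h1 h2 h3
    rintro i (rfl | rfl) <;> simp only [Set.mem_insert_iff, Set.mem_singleton_iff] <;> tauto)
    ).exists_isMate (n := n) (by omega)
  refine ⟨f, hf, fun r hr => ha _ ?_, fun r hr => hc _ ?_⟩
  · rcases hr with rfl | rfl | rfl | rfl
    · simp
    · right; left; push_cast; ring
    · simp
    · right; right; push_cast; simp; ring
  · rcases hr with rfl | rfl | rfl | rfl
    · simp
    · right; left; push_cast; ring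
    · simp
    · right; right; push_cast; simp; ring

/-- A single block of four columns. -/
lemma exists_isMate_one_block (hn : 8 ≤ n) (s : ZMod n) :
    ∃ f, (petersen n).IsMate f ∧
      (∀ r : ℕ, r = 0 ∨ r = 2 → f (.inl (s + r)) = .inl (s + r + 1)) ∧
      (∀ r : ℕ, 4 ≤ r → r < n → f (.inl (s + r)) = .inr (s + r)) ∧
      ∀ r : ℕ, r = 0 ∨ r = 1 → f (.inr (s + r)) = .inr (s + r + 2) := by
  have hne : ∀ k : ℕ, 0 < k → k < n → (k : ZMod n) ≠ 0 := fun k => zmod_natCast_ne_zero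
  obtain ⟨f, hf, ha, hb, hc⟩ := (isSelector_of_sparse (S := {s}) (by
    have h1 := hne 1 (by omega) (by omega)
    have h2 := hne 2 (by omega) (by omega)
    have h3 := hne 3 (by omega) (by omega)
    push_cast at h1 h2 h3
    rintro i rfl
    simp only [Set.mem_singleton_iff, add_eq_left]
    tauto)).exists_isMate (n := n) (by omega)
  refine ⟨f, hf, fun r hr => ha _ ?_, fun r h4 hr => hb _ ?_, fun r hr => hc _ ?_⟩
  · rcases hr with rfl | rfl
    · simp
    · simp
  · have hk : ∀ k : ℕ, k < 4 → s + r - (k : ZMod n) ∉ ({s} : Set (ZMod n)) := by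
      intro k hk h
      refine hne (r - k) (by omega) (by omega) ?_
      rw [Nat.cast_sub (by omega)]
      linear_combination Set.mem_singleton_iff.mp h
    have h0 := hk 0 (by omega)
    have h1 := hk 1 (by omega)
    have h2 := hk 2 (by omega)
    have h3 := hk 3 (by omega)
    push_cast at h0 h1 h2 h3
    rw [sub_zero] at h0
    exact ⟨h0, h1, h2, h3⟩
  · rcases hr with rfl | rfl
    · simp
    · simp

/-- Labels of columns along a cyclic sequence of blocks of three columns (labels `0, 1, 2`)
and blocks of four columns (labels `3, 4, 5, 6`). -/
def LabelStep (p q : ℕ) : Prop :=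
  (p = 0 ∧ q = 1) ∨ (p = 1 ∧ q = 2) ∨ (p = 3 ∧ q = 4) ∨ (p = 4 ∧ q = 5) ∨ (p = 5 ∧ q = 6) ∨
    ((p = 2 ∨ p = 6) ∧ (q = 0 ∨ q = 3))

lemma isSelector_of_labelStep {l : ZMod n → ℕ} (hl : ∀ i, LabelStep (l i) (l (i + 1))) :
    IsSelector (fun i => l i = 1 ∨ l i = 3 ∨ l i = 5) (fun i => l i = 0)
      (fun i => l i = 2 ∨ l i = 3 ∨ l i = 6) := by
  have e1 : ∀ i : ZMod n, i + 1 + 1 = i + 2 := fun i => by ring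
  have e2 : ∀ i : ZMod n, i - 2 + 1 = i - 1 := fun i => by ring
  have e3 : ∀ i : ZMod n, i - 1 + 1 = i := fun i => by ring
  have h1 := fun i => hl (i + 1)
  have h2 := fun i => hl (i - 2)
  have h3 := fun i => hl (i - 1)
  simp only [e1, e2, e3, LabelStep] at h1 h2 h3 hl
  constructor <;> intro i <;> have := hl i <;> have := h1 i <;> have := h2 i <;>
    have := h3 i <;> omega

/-- A matching containing a spoke and the inner edge that jumps over its column. -/
lemma exists_isMate_spoke_inner (hn : 9 ≤ n) (i : ZMod n) :
    ∃ f, (petersen n).IsMate f ∧ f (.inl (i + 1)) = .inr (i + 1) ∧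
      f (.inr i) = .inr (i + 2) := by
  have : NeZero n := ⟨by omega⟩
  obtain ⟨x, y, hx, hxy⟩ : ∃ x y : ℕ, 1 ≤ x ∧ 3 * x + 4 * y = n := by
    obtain h | h | h | h : n % 4 = 0 ∨ n % 4 = 1 ∨ n % 4 = 2 ∨ n % 4 = 3 := by omega
    · exact ⟨4, (n - 12) / 4, by omega, by omega⟩
    · exact ⟨3, (n - 9) / 4, by omega, by omega⟩
    · exact ⟨2, (n - 6) / 4, by omega, by omega⟩
    · exact ⟨1, (n - 3) / 4, by omega, by omega⟩
  let w : ℕ → ℕ := fun j => if j < 3 * x then j % 3 else 3 + (j - 3 * x) % 4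
  have hw : ∀ j, j + 1 < n → LabelStep (w j) (w (j + 1)) := by
    intro j hj
    simp only [w, LabelStep]
    split_ifs <;> omega
  have hlast : w (n - 1) = 2 ∨ w (n - 1) = 6 := by
    obtain h | ⟨h1, h2⟩ : n - 1 = 3 * (x - 1) + 2 ∨
        3 * x ≤ n - 1 ∧ n - 1 - 3 * x = 4 * (y - 1) + 3 := by omega
    · left
      simp only [w, if_pos (show n - 1 < 3 * x by omega)]
      omega
    · right
      simp only [w, if_neg h1.not_gt]
      omega
  have hzero : w 0 = 0 := by
    simp only [w]
    split_ifs <;> omega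
  obtain ⟨f, hf, -, hb, hc⟩ := (isSelector_of_labelStep
    (l := fun j : ZMod n => w (j - (i + 1)).val) (by
      intro j
      have hj : j + 1 - (i + 1) = (j - (i + 1)) + 1 := by ring
      rw [hj]
      generalize j - (i + 1) = z
      obtain ⟨k, hk, rfl⟩ : ∃ k < n, (k : ZMod n) = z := ⟨z.val, z.val_lt, by simp⟩
      rw [ZMod.val_natCast_of_lt hk]
      rcases Nat.lt_or_ge (k + 1) n with h | h
      · have := hw k h
        rwa [← Nat.cast_succ, ZMod.val_natCast_of_lt h]
      · obtain rfl : k = n - 1 := by omega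
        rw [← Nat.cast_succ, Nat.succ_eq_add_one, Nat.sub_add_cancel (by omega),
          ZMod.natCast_self, ZMod.val_zero, hzero]
        right; right; right; right; right
        exact ⟨hlast, .inl rfl⟩)).exists_isMate (n := n) (by omega)
  refine ⟨f, hf, hb _ (by simp [hzero]), hc _ ?_⟩
  have h1 : i - (i + 1) = ((n - 1 : ℕ) : ZMod n) := by
    rw [Nat.cast_sub (by omega), ZMod.natCast_self]
    push_cast
    ring
  simp only [h1]
  rw [ZMod.val_natCast_of_lt (by omega)]
  tauto

lemma zmod_exists_add_natCast [NeZero n] (i j : ZMod n) : ∃ d < n, j = i + (d : ℕ) :=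
  ⟨(j - i).val, (j - i).val_lt, by simp⟩

lemma exists_isMate_outer_outer (hn : 11 ≤ n) (i : ZMod n) {d : ℕ} (h2 : 2 ≤ d) (hd : d + 2 ≤ n) :
    ∃ f, (petersen n).IsMate f ∧ f (.inl i) = .inl (i + 1) ∧
      f (.inl (i + d)) = .inl (i + d + 1) := by
  rcases Nat.lt_or_ge d 6 with h | h
  · obtain ⟨f, hf, ha, -⟩ := exists_isMate_two_blocks (n := n) (m := d + 2) (by omega) (by omega)
      (i - 2)
    have hi := ha 2 (by omega)
    have hj := ha (d + 2) (by omega)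
    push_cast at hi hj
    rw [sub_add_cancel] at hi
    rw [show i - 2 + ((d : ZMod n) + 2) = i + d by ring] at hj
    exact ⟨f, hf, hi, hj⟩
  · obtain ⟨f, hf, ha, -⟩ := exists_isMate_two_blocks (n := n) (m := d - 2) (by omega) (by omega) i
    have hi := ha 0 (by omega)
    rw [Nat.cast_zero, add_zero] at hi
    exact ⟨f, hf, hi, ha d (by omega)⟩

lemma exists_isMate_inner_inner (hn : 11 ≤ n) (i : ZMod n) {d : ℕ} (h0 : d ≠ 0) (h2 : d ≠ 2)
    (hd : d < n) (hd2 : d + 2 ≠ n) :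
    ∃ f, (petersen n).IsMate f ∧ f (.inr i) = .inr (i + 2) ∧
      f (.inr (i + d)) = .inr (i + d + 2) := by
  obtain rfl | h | h | rfl : d = 1 ∨ (3 ≤ d ∧ d < 5) ∨ (5 ≤ d ∧ d + 3 ≤ n) ∨ n = d + 1 := by omega
  · obtain ⟨f, hf, -, -, hc⟩ := exists_isMate_one_block (n := n) (by omega) i
    have hi := hc 0 (by omega)
    rw [Nat.cast_zero, add_zero] at hi
    exact ⟨f, hf, hi, hc 1 (by omega)⟩
  · obtain ⟨f, hf, -, hc⟩ := exists_isMate_two_blocks (n := n) (m := d + 1) (by omega) (by omega)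
      (i - 1)
    have hi := hc 1 (by omega)
    have hj := hc (d + 1) (by omega)
    push_cast at hi hj
    rw [sub_add_cancel] at hi
    rw [show i - 1 + ((d : ZMod n) + 1) = i + d by ring] at hj
    exact ⟨f, hf, hi, hj⟩
  · obtain ⟨f, hf, -, hc⟩ := exists_isMate_two_blocks (n := n) (m := d - 1) (by omega) (by omega) i
    have hi := hc 0 (by omega)
    rw [Nat.cast_zero, add_zero] at hi
    exact ⟨f, hf, hi, hc d (by omega)⟩
  · have hcast : (d : ZMod (d + 1)) = -1 := by
      have := ZMod.natCast_self (d + 1)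
      push_cast at this
      linear_combination this
    obtain ⟨f, hf, -, -, hc⟩ := exists_isMate_one_block (n := d + 1) (by omega) (i - 1)
    have hi := hc 1 (by omega)
    have hj := hc 0 (by omega)
    push_cast at hi hj
    rw [sub_add_cancel] at hi
    rw [add_zero] at hj
    refine ⟨f, hf, hi, ?_⟩
    rwa [hcast, ← sub_eq_add_neg]

lemma exists_isMate_outer_inner (hn : 11 ≤ n) (i : ZMod n) {d : ℕ} (hd : d < n) :
    ∃ f, (petersen n).IsMate f ∧ f (.inl i) = .inl (i + 1) ∧
      f (.inr (i + d)) = .inr (i + d + 2) := by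
  obtain h | h | h | ⟨e, he, h⟩ : d < 2 ∨ (2 ≤ d ∧ d < 5) ∨ (5 ≤ d ∧ d + 3 ≤ n) ∨
      ∃ e < 2, n + e = d + 2 := by
    by_cases n ≤ d + 2
    · exact .inr (.inr (.inr ⟨d + 2 - n, by omega, by omega⟩))
    · omega
  · obtain ⟨f, hf, ha, -, hc⟩ := exists_isMate_one_block (n := n) (by omega) i
    have hi := ha 0 (by omega)
    rw [Nat.cast_zero, add_zero] at hi
    exact ⟨f, hf, hi, hc d (by omega)⟩
  · obtain ⟨f, hf, ha, hc⟩ := exists_isMate_two_blocks (n := n) (m := d + 2) (by omega) (by omega)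
      (i - 2)
    have hi := ha 2 (by omega)
    have hj := hc (d + 2) (by omega)
    push_cast at hi hj
    rw [sub_add_cancel] at hi
    rw [show i - 2 + ((d : ZMod n) + 2) = i + d by ring] at hj
    exact ⟨f, hf, hi, hj⟩
  · obtain ⟨f, hf, ha, hc⟩ := exists_isMate_two_blocks (n := n) (m := d - 1) (by omega) (by omega) i
    have hi := ha 0 (by omega)
    rw [Nat.cast_zero, add_zero] at hi
    exact ⟨f, hf, hi, hc d (by omega)⟩
  · have hcast : (e : ZMod n) = d + 2 := by
      have := congrArg (Nat.cast (R := ZMod n)) h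
      push_cast at this
      rwa [ZMod.natCast_self, zero_add] at this
    obtain ⟨f, hf, ha, -, hc⟩ := exists_isMate_one_block (n := n) (by omega) (i - 2)
    have hi := ha 2 (by omega)
    have hj := hc e (by omega)
    push_cast at hi
    rw [sub_add_cancel] at hi
    rw [show i - 2 + (e : ZMod n) = i + d by rw [hcast]; ring] at hj
    exact ⟨f, hf, hi, hj⟩

lemma exists_isMate_outer_spoke (hn : 11 ≤ n) (i : ZMod n) {d : ℕ} (h2 : 2 ≤ d) (hd : d < n) :
    ∃ f, (petersen n).IsMate f ∧ f (.inl i) = .inl (i + 1) ∧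
      f (.inl (i + d)) = .inr (i + d) := by
  rcases Nat.lt_or_ge d 4 with h | h
  · obtain ⟨f, hf, ha, hb, -⟩ := exists_isMate_one_block (n := n) (by omega) (i - 2)
    have hi := ha 2 (by omega)
    have hj := hb (d + 2) (by omega) (by omega)
    push_cast at hi hj
    rw [sub_add_cancel] at hi
    rw [show i - 2 + ((d : ZMod n) + 2) = i + d by ring] at hj
    exact ⟨f, hf, hi, hj⟩
  · obtain ⟨f, hf, ha, hb, -⟩ := exists_isMate_one_block (n := n) (by omega) i
    have hi := ha 0 (by omega)
    rw [Nat.cast_zero, add_zero] at hi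
    exact ⟨f, hf, hi, hb d h hd⟩

lemma exists_isMate_inner_spoke (hn : 11 ≤ n) (i : ZMod n) {d : ℕ} (h0 : d ≠ 0) (h2 : d ≠ 2)
    (hd : d < n) :
    ∃ f, (petersen n).IsMate f ∧ f (.inr i) = .inr (i + 2) ∧
      f (.inl (i + d)) = .inr (i + d) := by
  obtain rfl | rfl | h : d = 1 ∨ d = 3 ∨ 4 ≤ d := by omega
  · obtain ⟨f, hf, h1, h2⟩ := exists_isMate_spoke_inner (n := n) (by omega) i
    exact ⟨f, hf, h2, by simpa using h1⟩
  · obtain ⟨f, hf, -, hb, hc⟩ := exists_isMate_one_block (n := n) (by omega) (i - 1)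
    have hi := hc 1 (by omega)
    have hj := hb 4 (by omega) (by omega)
    push_cast at hi hj
    rw [sub_add_cancel] at hi
    rw [show i - 1 + (4 : ZMod n) = i + (3 : ℕ) by push_cast; ring] at hj
    exact ⟨f, hf, hi, hj⟩
  · obtain ⟨f, hf, -, hb, hc⟩ := exists_isMate_one_block (n := n) (by omega) i
    have hi := hc 0 (by omega)
    rw [Nat.cast_zero, add_zero] at hi
    exact ⟨f, hf, hi, hb d h hd⟩

lemma exists_isMate_spoke_spoke (hn : 11 ≤ n) (i j : ZMod n) :
    ∃ f, (petersen n).IsMate f ∧ f (.inl i) = .inr i ∧ f (.inl j) = .inr j := by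
  obtain ⟨f, hf, -, hb, -⟩ :=
    (isSelector_of_sparse (S := (∅ : Set (ZMod n))) (by simp)).exists_isMate (by omega)
  exact ⟨f, hf, hb _ (by simp), hb _ (by simp)⟩

lemma petersen_pairExtends_arc (hn : 11 ≤ n) {x y z w : ZMod n ⊕ ZMod n}
    (hxy : PetersenArc n x y) (hzw : PetersenArc n z w)
    (hxz : x ≠ z) (hxw : x ≠ w) (hyz : y ≠ z) (hyw : y ≠ w) :
    ∃ f, (petersen n).IsMate f ∧ f x = y ∧ f z = w := by
  have : NeZero n := ⟨by omega⟩
  have hneg : ∀ {d k : ℕ}, d + k = n → (d : ZMod n) = -k := by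
    intro d k h
    have := ZMod.natCast_self n
    rw [← h] at this ⊢
    push_cast at this
    linear_combination this
  have outer_spoke : ∀ i j : ZMod n, (Sum.inl i : ZMod n ⊕ ZMod n) ≠ .inl j →
      (Sum.inl (i + 1) : ZMod n ⊕ ZMod n) ≠ .inl j →
      ∃ f, (petersen n).IsMate f ∧ f (.inl i) = .inl (i + 1) ∧ f (.inl j) = .inr j := by
    intro i j h1 h2
    obtain ⟨d, hd, rfl⟩ := zmod_exists_add_natCast i j
    have : d ≠ 0 := by
      rintro rfl
      simp at h1
    have : d ≠ 1 := by
      rintro rfl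
      simp at h2
    exact exists_isMate_outer_spoke hn i (by omega) hd
  have inner_spoke : ∀ i j : ZMod n, (Sum.inr i : ZMod n ⊕ ZMod n) ≠ .inr j →
      (Sum.inr (i + 2) : ZMod n ⊕ ZMod n) ≠ .inr j →
      ∃ f, (petersen n).IsMate f ∧ f (.inr i) = .inr (i + 2) ∧ f (.inl j) = .inr j := by
    intro i j h1 h2
    obtain ⟨d, hd, rfl⟩ := zmod_exists_add_natCast i j
    refine exists_isMate_inner_spoke hn i ?_ ?_ hd
    · rintro rfl
      simp at h1
    · rintro rfl
      simp at h2
  have outer_inner : ∀ i j : ZMod n, ∃ f, (petersen n).IsMate f ∧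
      f (.inl i) = .inl (i + 1) ∧ f (.inr j) = .inr (j + 2) := by
    intro i j
    obtain ⟨d, hd, rfl⟩ := zmod_exists_add_natCast i j
    exact exists_isMate_outer_inner hn i hd
  rcases hxy with i | i | i <;> rcases hzw with j | j | j
  · obtain ⟨d, hd, rfl⟩ := zmod_exists_add_natCast i j
    have : d ≠ 0 := by
      rintro rfl
      simp at hxz
    have : d ≠ 1 := by
      rintro rfl
      simp at hyz
    have : d + 1 ≠ n := by
      intro h
      simp [hneg h] at hxw
    exact exists_isMate_outer_outer hn i (by omega) (by omega)
  · exact outer_spoke i j hxz hyz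
  · exact outer_inner i j
  · obtain ⟨f, hf, h1, h2⟩ := outer_spoke j i hxz.symm hxw.symm
    exact ⟨f, hf, h2, h1⟩
  · exact exists_isMate_spoke_spoke hn i j
  · obtain ⟨f, hf, h1, h2⟩ := inner_spoke j i hyz.symm hyw.symm
    exact ⟨f, hf, h2, h1⟩
  · obtain ⟨f, hf, h1, h2⟩ := outer_inner j i
    exact ⟨f, hf, h2, h1⟩
  · exact inner_spoke i j hxw hyw
  · obtain ⟨d, hd, rfl⟩ := zmod_exists_add_natCast i j
    refine exists_isMate_inner_inner hn i ?_ ?_ hd ?_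
    · rintro rfl
      simp at hxz
    · rintro rfl
      simp at hyz
    · intro h
      simp [hneg h] at hxw

lemma petersen_pairExtends (hn : 11 ≤ n) : (petersen n).PairExtends := by
  rintro a b c d ⟨-, hab⟩ ⟨-, hcd⟩ hac had hbc hbd
  rcases hab with hab | hab <;> rcases hcd with hcd | hcd
  · exact petersen_pairExtends_arc hn hab hcd hac had hbc hbd
  · obtain ⟨f, hf, h1, rfl⟩ := petersen_pairExtends_arc hn hab hcd had hac hbd hbc
    exact ⟨f, hf, h1, hf.invol _⟩
  · obtain ⟨f, hf, rfl, h2⟩ := petersen_pairExtends_arc hn hab hcd hbc hbd hac had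
    exact ⟨f, hf, hf.invol _, h2⟩
  · obtain ⟨f, hf, rfl, rfl⟩ := petersen_pairExtends_arc hn hab hcd hbd hbc had hac
    exact ⟨f, hf, hf.invol _, hf.invol _⟩

lemma exists_cubic_of_eleven_le (hn : 11 ≤ n) :
    ∃ G : SimpleGraph (Fin (2 * n)), IsExtendable G 2 ∧ ¬ G.Colorable 2 ∧
      (∀ v, (G.neighborSet v).ncard = 3) ∧ G.edgeSet.ncard = 3 * (2 * n) / 2 := by
  have : NeZero n := ⟨by omega⟩
  have h2 := zmod_natCast_ne_zero (n := n) (k := 2) (by omega) (by omega)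
  push_cast at h2
  have hcycle := petersen_adj_outer (n := n) (by omega)
  have h12 := hcycle 1
  rw [one_add_one_eq_two] at h12
  have h02 := petersen_adj_inner (n := n) (by omega) 0
  have h01 := hcycle 0
  rw [zero_add] at h02 h01
  exact exists_fin_of_cubic (by simp [ZMod.card, two_mul]) (petersen_connected (by omega))
    (petersen_ncard_neighborSet (by omega)) (petersen_pairExtends hn) h01 h12
    (petersen_adj_spoke 2) h02.symm (petersen_adj_spoke 0).symm (by simpa using h2.symm)
    (by simp) (by simp)

end Petersen

section SmallOrders

/-- The neighbours of `v` in the cycle `0, 1, …, m - 1` with the chords `ch`. -/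
def chordNeighbors (m : ℕ) (ch : List ℕ) (v : ℕ) : List ℕ :=
  [(v + 1) % m, (v + (m - 1)) % m, ch.getD v 0]

/-- The cycle with chords `ch` is a cubic graph in which every two disjoint edges lie in one of
the perfect matchings `Ms`, each given by its list of mates. -/
def MatesCover (m : ℕ) (ch : List ℕ) (Ms : List (List ℕ)) : Prop :=
  (∀ v < m, (chordNeighbors m ch v).Nodup ∧
    ∀ w ∈ chordNeighbors m ch v, w < m ∧ w ≠ v ∧ v ∈ chordNeighbors m ch w) ∧
  (∀ l ∈ Ms, ∀ v < m, l.getD v 0 ∈ chordNeighbors m ch v ∧ l.getD (l.getD v 0) 0 = v) ∧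
  ∀ v < m, ∀ w ∈ chordNeighbors m ch v, ∀ x < m, ∀ y ∈ chordNeighbors m ch x,
    v = x ∨ v = y ∨ w = x ∨ w = y ∨ ∃ l ∈ Ms, l.getD v 0 = w ∧ l.getD x 0 = y

instance (m : ℕ) (ch : List ℕ) (Ms : List (List ℕ)) : Decidable (MatesCover m ch Ms) := by
  unfold MatesCover
  infer_instance

/-- The graph on `Fin m` whose adjacency is given by `chordNeighbors`. -/
def chordGraph (m : ℕ) (ch : List ℕ) : SimpleGraph (Fin m) :=
  fromRel fun x y => y.val ∈ chordNeighbors m ch x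

lemma MatesCover.adj_iff {m : ℕ} {ch : List ℕ} {Ms : List (List ℕ)} (h : MatesCover m ch Ms)
    {x y : Fin m} : (chordGraph m ch).Adj x y ↔ y.val ∈ chordNeighbors m ch x := by
  constructor
  · rintro ⟨-, hxy | hxy⟩
    · exact hxy
    · exact ((h.1 y y.2).2 x hxy).2.2
  · intro hxy
    exact ⟨fun he => ((h.1 x x.2).2 y hxy).2.1 (by rw [he]), .inl hxy⟩

lemma MatesCover.exists_cubic {m : ℕ} {ch : List ℕ} {Ms : List (List ℕ)}
    (h : MatesCover m ch Ms) (hm : 5 ≤ m) (hch : ch.getD 0 0 = 4) :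
    ∃ G : SimpleGraph (Fin m), IsExtendable G 2 ∧ ¬ G.Colorable 2 ∧
      (∀ v, (G.neighborSet v).ncard = 3) ∧ G.edgeSet.ncard = 3 * m / 2 := by
  have hsucc : ∀ k, (hk : k + 1 < m) →
      (chordGraph m ch).Adj ⟨k, by omega⟩ ⟨k + 1, hk⟩ := by
    intro k hk
    rw [h.adj_iff]
    simp [chordNeighbors, Nat.mod_eq_of_lt hk]
  refine exists_fin_of_cubic (G := chordGraph m ch) (Fintype.card_fin m) ?_ ?_ ?_
    (hsucc 0 (by omega)) (hsucc 1 (by omega)) (hsucc 2 (by omega)) (hsucc 3 (by omega))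
    (h.adj_iff (y := ⟨0, by omega⟩) |>.mpr ?_) (by simp) (by simp) (by simp)
  · rw [connected_iff_exists_forall_reachable]
    refine ⟨⟨0, by omega⟩, fun ⟨k, hk⟩ => ?_⟩
    induction k with
    | zero => exact .rfl
    | succ k ih => exact (ih (by omega)).trans (hsucc k hk).reachable
  · intro v
    have himage : Fin.val '' (chordGraph m ch).neighborSet v =
        ((chordNeighbors m ch v).toFinset : Set ℕ) := by
      ext w
      simp only [Set.mem_image, mem_neighborSet, h.adj_iff, List.coe_toFinset, Set.mem_ofPred_eq]
      exact ⟨by rintro ⟨x, hx, rfl⟩; exact hx,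
        fun hw => ⟨⟨w, ((h.1 v v.2).2 w hw).1⟩, hw, rfl⟩⟩
    rw [← Set.ncard_image_of_injective _ Fin.val_injective, himage, Set.ncard_coe_finset,
      List.toFinset_card_of_nodup (h.1 v v.2).1]
    rfl
  · intro a b c d hab hcd hac had hbc hbd
    rw [h.adj_iff] at hab hcd
    rw [Ne, Fin.ext_iff] at hac had hbc hbd
    obtain ⟨l, hl, h1, h2⟩ := ((((h.2.2 a a.2 b hab c c.2 d hcd).resolve_left hac).resolve_left
      had).resolve_left hbc).resolve_left hbd
    have hlt := fun v : Fin m => ((h.1 v v.2).2 _ (h.2.1 l hl v v.2).1).1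
    exact ⟨fun v => ⟨l.getD v 0, hlt v⟩, ⟨fun v => h.adj_iff.mpr (h.2.1 l hl v v.2).1,
      fun v => Fin.ext (h.2.1 l hl v v.2).2⟩, Fin.ext h1, Fin.ext h2⟩
  · refine (h.1 0 (by omega)).2 4 ?_ |>.2.2
    rw [chordNeighbors, hch]
    simp

lemma matesCover_14 : MatesCover 14
    [4, 9, 11, 7, 0, 12, 10, 3, 13, 1, 6, 2, 5, 8]
    [[1, 0, 3, 2, 5, 4, 7, 6, 9, 8, 11, 10, 13, 12],
     [13, 2, 1, 4, 3, 6, 5, 8, 7, 10, 9, 12, 11, 0],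
     [4, 9, 11, 7, 0, 12, 10, 3, 13, 1, 6, 2, 5, 8],
     [1, 0, 11, 4, 3, 12, 7, 6, 13, 10, 9, 2, 5, 8],
     [13, 2, 1, 7, 5, 4, 10, 3, 9, 8, 6, 12, 11, 0],
     [4, 9, 3, 2, 0, 6, 5, 8, 7, 1, 11, 10, 13, 12],
     [13, 2, 1, 4, 3, 12, 7, 6, 9, 8, 11, 10, 5, 0],
     [1, 0, 3, 2, 5, 4, 7, 6, 13, 10, 9, 12, 11, 8],
     [1, 0, 11, 4, 3, 6, 5, 8, 7, 10, 9, 2, 13, 12],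
     [13, 9, 3, 2, 5, 4, 10, 8, 7, 1, 6, 12, 11, 0],
     [4, 2, 1, 7, 0, 6, 5, 3, 9, 8, 11, 10, 13, 12],
     [1, 0, 11, 7, 5, 4, 10, 3, 9, 8, 6, 2, 13, 12],
     [4, 2, 1, 7, 0, 6, 5, 3, 13, 10, 9, 12, 11, 8],
     [13, 9, 11, 4, 3, 12, 10, 8, 7, 1, 6, 2, 5, 0],
     [4, 9, 3, 2, 0, 12, 7, 6, 13, 1, 11, 10, 5, 8]] := by
  decide +kernel

lemma matesCover_16 : MatesCover 16
    [4, 11, 13, 6, 0, 9, 3, 14, 12, 5, 15, 1, 8, 2, 7, 10]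
    [[1, 0, 3, 2, 5, 4, 7, 6, 9, 8, 11, 10, 13, 12, 15, 14],
     [15, 2, 1, 4, 3, 6, 5, 8, 7, 10, 9, 12, 11, 14, 13, 0],
     [4, 11, 13, 6, 0, 9, 3, 14, 12, 5, 15, 1, 8, 2, 7, 10],
     [1, 0, 13, 4, 3, 6, 5, 14, 9, 8, 15, 12, 11, 2, 7, 10],
     [15, 11, 3, 2, 5, 4, 7, 6, 12, 10, 9, 1, 8, 14, 13, 0],
     [4, 2, 1, 6, 0, 9, 3, 8, 7, 5, 11, 10, 13, 12, 15, 14],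
     [1, 0, 13, 6, 5, 4, 3, 8, 7, 10, 9, 12, 11, 2, 15, 14],
     [1, 0, 13, 4, 3, 9, 7, 6, 12, 5, 11, 10, 8, 2, 15, 14],
     [15, 2, 1, 6, 5, 4, 3, 14, 9, 8, 11, 10, 13, 12, 7, 0],
     [4, 11, 3, 2, 0, 6, 5, 8, 7, 10, 9, 1, 13, 12, 15, 14],
     [1, 0, 3, 2, 5, 4, 7, 6, 9, 8, 15, 12, 11, 14, 13, 10],
     [4, 2, 1, 6, 0, 9, 3, 8, 7, 5, 15, 12, 11, 14, 13, 10],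
     [15, 2, 1, 4, 3, 9, 7, 6, 12, 5, 11, 10, 8, 14, 13, 0],
     [15, 11, 13, 4, 3, 6, 5, 14, 12, 10, 9, 1, 8, 2, 7, 0],
     [4, 11, 3, 2, 0, 6, 5, 14, 9, 8, 15, 1, 13, 12, 7, 10],
     [15, 2, 1, 4, 3, 6, 5, 14, 9, 8, 11, 10, 13, 12, 7, 0],
     [4, 11, 3, 2, 0, 9, 7, 6, 12, 5, 15, 1, 8, 14, 13, 10]] := by
  decide +kernel

lemma matesCover_18 : MatesCover 18
    [4, 15, 9, 13, 0, 12, 16, 14, 11, 2, 17, 8, 5, 3, 7, 1, 6, 10]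
    [[1, 0, 3, 2, 5, 4, 7, 6, 9, 8, 11, 10, 13, 12, 15, 14, 17, 16],
     [1, 0, 9, 4, 3, 6, 5, 8, 7, 2, 17, 12, 11, 14, 13, 16, 15, 10],
     [4, 15, 9, 13, 0, 12, 16, 14, 11, 2, 17, 8, 5, 3, 7, 1, 6, 10],
     [17, 2, 1, 13, 5, 4, 16, 8, 7, 10, 9, 12, 11, 3, 15, 14, 6, 0],
     [17, 2, 1, 4, 3, 6, 5, 14, 9, 8, 11, 10, 13, 12, 7, 16, 15, 0],
     [4, 15, 3, 2, 0, 12, 7, 6, 11, 10, 9, 8, 5, 14, 13, 1, 17, 16],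
     [17, 2, 1, 4, 3, 12, 7, 6, 11, 10, 9, 8, 5, 14, 13, 16, 15, 0],
     [17, 15, 9, 4, 3, 12, 16, 8, 7, 2, 11, 10, 5, 14, 13, 1, 6, 0],
     [4, 2, 1, 13, 0, 6, 5, 8, 7, 10, 9, 12, 11, 3, 15, 14, 17, 16],
     [1, 0, 3, 2, 5, 4, 7, 6, 9, 8, 17, 12, 11, 14, 13, 16, 15, 10],
     [17, 15, 3, 2, 5, 4, 16, 14, 11, 10, 9, 8, 13, 12, 7, 1, 6, 0],
     [4, 2, 1, 13, 0, 12, 7, 6, 9, 8, 11, 10, 5, 3, 15, 14, 17, 16],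
     [1, 0, 9, 4, 3, 6, 5, 8, 7, 2, 11, 10, 13, 12, 15, 14, 17, 16],
     [4, 15, 3, 2, 0, 6, 5, 14, 9, 8, 11, 10, 13, 12, 7, 1, 17, 16],
     [1, 0, 9, 4, 3, 6, 5, 14, 11, 2, 17, 8, 13, 12, 7, 16, 15, 10],
     [1, 0, 9, 13, 5, 4, 16, 8, 7, 2, 17, 12, 11, 3, 15, 14, 6, 10],
     [4, 2, 1, 13, 0, 6, 5, 14, 9, 8, 17, 12, 11, 3, 7, 16, 15, 10],
     [1, 0, 3, 2, 5, 4, 7, 6, 11, 10, 9, 8, 13, 12, 15, 14, 17, 16],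
     [1, 0, 9, 4, 3, 12, 7, 6, 11, 2, 17, 8, 5, 14, 13, 16, 15, 10],
     [17, 15, 3, 2, 5, 4, 16, 8, 7, 10, 9, 12, 11, 14, 13, 1, 6, 0],
     [17, 15, 3, 2, 5, 4, 16, 14, 9, 8, 11, 10, 13, 12, 7, 1, 6, 0]] := by
  decide +kernel

lemma matesCover_20 : MatesCover 20
    [4, 11, 13, 7, 0, 16, 18, 3, 19, 14, 17, 1, 15, 2, 9, 12, 5, 10, 6, 8]
    [[1, 0, 3, 2, 5, 4, 7, 6, 9, 8, 11, 10, 13, 12, 15, 14, 17, 16, 19, 18],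
     [19, 2, 1, 4, 3, 6, 5, 8, 7, 10, 9, 12, 11, 14, 13, 16, 15, 18, 17, 0],
     [4, 11, 13, 7, 0, 16, 18, 3, 19, 14, 17, 1, 15, 2, 9, 12, 5, 10, 6, 8],
     [1, 0, 13, 4, 3, 6, 5, 8, 7, 14, 11, 10, 15, 2, 9, 12, 17, 16, 19, 18],
     [19, 11, 3, 2, 5, 4, 18, 8, 7, 14, 17, 1, 13, 12, 9, 16, 15, 10, 6, 0],
     [1, 0, 13, 4, 3, 16, 7, 6, 19, 10, 9, 12, 11, 2, 15, 14, 5, 18, 17, 8],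
     [4, 2, 1, 7, 0, 6, 5, 3, 9, 8, 17, 12, 11, 14, 13, 16, 15, 10, 19, 18],
     [19, 2, 1, 7, 5, 4, 18, 3, 9, 8, 11, 10, 15, 14, 13, 12, 17, 16, 6, 0],
     [4, 11, 3, 2, 0, 16, 7, 6, 19, 10, 9, 1, 15, 14, 13, 12, 5, 18, 17, 8],
     [4, 2, 1, 7, 0, 6, 5, 3, 19, 14, 11, 10, 13, 12, 9, 16, 15, 18, 17, 8],
     [1, 0, 13, 7, 5, 4, 18, 3, 19, 10, 9, 12, 11, 2, 15, 14, 17, 16, 6, 8],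
     [19, 2, 1, 4, 3, 16, 7, 6, 9, 8, 11, 10, 13, 12, 15, 14, 5, 18, 17, 0],
     [4, 11, 3, 2, 0, 6, 5, 8, 7, 10, 9, 1, 13, 12, 15, 14, 17, 16, 19, 18],
     [1, 0, 3, 2, 5, 4, 7, 6, 9, 8, 17, 12, 11, 14, 13, 16, 15, 10, 19, 18],
     [19, 11, 13, 4, 3, 16, 18, 8, 7, 14, 17, 1, 15, 2, 9, 12, 5, 10, 6, 0],
     [1, 0, 13, 4, 3, 16, 7, 6, 9, 8, 17, 12, 11, 2, 15, 14, 5, 10, 19, 18],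
     [1, 0, 3, 2, 5, 4, 7, 6, 19, 14, 11, 10, 13, 12, 9, 16, 15, 18, 17, 8],
     [1, 0, 13, 4, 3, 6, 5, 8, 7, 14, 17, 12, 11, 2, 9, 16, 15, 10, 19, 18],
     [4, 11, 3, 2, 0, 16, 7, 6, 9, 8, 17, 1, 13, 12, 15, 14, 5, 10, 19, 18]] := by
  decide +kernel

end SmallOrders

end SimpleGraph

theorem eps_large_two (ν : ℕ) (heven : Even ν) (hν : 14 ≤ ν) :
    (∀ (V : Type) [Fintype V] (G : SimpleGraph V), Fintype.card V = ν →
      IsExtendable G 2 → ¬ G.Colorable 2 → 3 * ν / 2 ≤ G.edgeSet.ncard) ∧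
    (∃ G : SimpleGraph (Fin ν), IsExtendable G 2 ∧ ¬ G.Colorable 2 ∧
      (∀ v, (G.neighborSet v).ncard = 3) ∧ G.edgeSet.ncard = 3 * ν / 2) := by
  constructor
  · intro V _ G hcard h _
    have hsum : Fintype.card V * 3 ≤ ∑ v, (G.neighborSet v).ncard := by
      rw [← smul_eq_mul, ← Finset.card_univ, ← Finset.sum_const]
      exact Finset.sum_le_sum fun v _ => three_le_ncard_neighborSet h (by omega) v
    rw [← two_mul_ncard_edgeSet] at hsum
    omega
  · obtain ⟨n, rfl⟩ := heven.two_dvd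
    rcases Nat.lt_or_ge n 11 with hn | hn
    · obtain rfl | rfl | rfl | rfl : n = 7 ∨ n = 8 ∨ n = 9 ∨ n = 10 := by omega
      · exact matesCover_14.exists_cubic (by norm_num) rfl
      · exact matesCover_16.exists_cubic (by norm_num) rfl
      · exact matesCover_18.exists_cubic (by norm_num) rfl
      · exact matesCover_20.exists_cubic (by norm_num) rfl
    · exact exists_cubic_of_eleven_le hn
end

section
/- Let k ≥ 2 be an integer. Let G be the finite simple graph obtained from two disjoint copies of the complete graph K_{2k}, with vertex sets {u_0,…,u_{2k−1}} and {v_0,…,v_{2k−1}}, by joining u_i to v_i for every 0 ≤ i ≤ 2k−1 (i.e., the Cartesian product K_{2k} □ K_2). Then G is a k-extendable non-bipartite 2k-regular graph on 4k vertices with exactly 4k² edges; moreover every k-extendable non-bipartite finite simple graph on 4k vertices has at least 4k² edges. Hence ε(4k,k) = 4k². -/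
open SimpleGraph

section MatchingMap

variable {V : Type*} {G : SimpleGraph V} {f g p : V → V}

/-- A matching of `G`, encoded as the involution that swaps the ends of each of its edges. -/
structure IsMatchingMap (G : SimpleGraph V) (f : V → V) : Prop where
  invol : ∀ x, f (f x) = x
  adj : ∀ x, f x ≠ x → G.Adj x (f x)

/-- The set of vertices moved by a function; for a matching, the set of covered vertices. -/
def moved [Fintype V] [DecidableEq V] (f : V → V) : Finset V :=
  Finset.univ.filter fun x => f x ≠ x

theorem IsMatchingMap.injective (hf : IsMatchingMap G f) : Function.Injective f :=
  Function.Involutive.injective hf.invol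

theorem IsMatchingMap.id : IsMatchingMap G id := ⟨fun _ => rfl, fun _ h => absurd rfl h⟩

theorem IsMatchingMap.even_card [DecidableEq V] (hf : IsMatchingMap G f) {C : Finset V}
    (hC : ∀ x ∈ C, f x ∈ C ∧ f x ≠ x) : Even C.card := by
  have h : ∑ x ∈ C, (1 : ZMod 2) = 0 :=
    Finset.sum_involution (fun x _ => f x) (fun _ _ => by decide) (fun x hx _ => (hC x hx).2)
      (fun x hx => (hC x hx).1) (fun x _ => hf.invol x)
  rw [Finset.sum_const, nsmul_eq_mul, mul_one] at h
  exact (ZMod.natCast_eq_zero_iff_even).1 h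

/-- The matching consisting of the edges of `f` inside `N`. -/
def restrictTo [DecidableEq V] (f : V → V) (N : Finset V) : V → V :=
  fun x => if x ∈ N ∧ f x ∈ N then f x else x

theorem IsMatchingMap.restrictTo [DecidableEq V] (hf : IsMatchingMap G f) (N : Finset V) :
    IsMatchingMap G (restrictTo f N) := by
  constructor
  · intro x
    have := hf.invol x
    unfold _root_.restrictTo
    grind
  · intro x
    have := hf.adj x
    unfold _root_.restrictTo
    grind

/-- The union of two matchings. -/
def unionMap [DecidableEq V] (f g : V → V) : V → V :=
  fun x => if f x = x then g x else f x

theorem isMatchingMap_swap [DecidableEq V] {a b : V} (h : G.Adj a b) :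
    IsMatchingMap G (Equiv.swap a b) := by
  constructor
  · intro x; simp
  · intro x hx
    have := h.symm
    rcases eq_or_ne x a with rfl | ha
    · simpa
    rcases eq_or_ne x b with rfl | hb
    · simpa
    exact absurd (Equiv.swap_apply_of_ne_of_ne ha hb) hx

variable [Fintype V] [DecidableEq V]

@[simp]
theorem mem_moved {x : V} : x ∈ moved f ↔ f x ≠ x := by simp [moved]

theorem IsMatchingMap.map_mem_moved (hf : IsMatchingMap G f) {x : V} (hx : x ∈ moved f) :
    f x ∈ moved f := by
  rw [mem_moved] at *
  rw [hf.invol]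
  exact hx.symm

theorem IsMatchingMap.even_card_moved (hf : IsMatchingMap G f) : Even (moved f).card :=
  hf.even_card fun _ hx => ⟨hf.map_mem_moved hx, mem_moved.1 hx⟩

theorem moved_id : moved (id : V → V) = ∅ := by
  ext; simp

theorem IsMatchingMap.unionMap (hf : IsMatchingMap G f) (hg : IsMatchingMap G g)
    (h : Disjoint (moved f) (moved g)) : IsMatchingMap G (unionMap f g) := by
  have key : ∀ x, f x ≠ x → g x = x := fun x hx => by
    by_contra hx'
    exact Finset.disjoint_left.1 h (mem_moved.2 hx) (mem_moved.2 hx')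
  constructor
  · intro x
    have h1 := hf.invol x
    have h2 := hg.invol x
    have h3 := key (g x)
    have h4 := key x
    unfold _root_.unionMap
    grind
  · intro x
    have h1 := hf.adj x
    have h2 := hg.adj x
    unfold _root_.unionMap
    grind

theorem moved_unionMap : moved (unionMap f g) = moved f ∪ moved g := by
  ext x
  simp only [unionMap, mem_moved, Finset.mem_union]
  grind

theorem unionMap_apply_left {x : V} (hx : x ∈ moved f) : unionMap f g x = f x := by
  rw [mem_moved] at hx
  simp [unionMap, hx]

theorem unionMap_apply_right (h : Disjoint (moved f) (moved g)) {x : V} (hx : x ∈ moved g) :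
    unionMap f g x = g x := by
  have := Finset.disjoint_right.1 h hx
  rw [mem_moved, not_not] at this
  simp [unionMap, this]

theorem moved_swap {a b : V} (h : a ≠ b) : moved (Equiv.swap a b) = {a, b} := by
  ext x
  simp only [mem_moved, Finset.mem_insert, Finset.mem_singleton]
  constructor
  · intro hx
    by_contra! hc
    exact hx (Equiv.swap_apply_of_ne_of_ne hc.1 hc.2)
  · rintro (rfl | rfl)
    · simpa using h.symm
    · simpa using h

theorem moved_restrictTo_subset (N : Finset V) : moved (restrictTo f N) ⊆ N := by
  intro x
  simp only [restrictTo, mem_moved]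
  grind

theorem mem_moved_restrictTo {N : Finset V} {x : V} :
    x ∈ moved (restrictTo f N) ↔ x ∈ N ∧ f x ∈ N ∧ x ∈ moved f := by
  simp only [restrictTo, mem_moved]
  grind

theorem restrictTo_apply {N : Finset V} {x : V} (hx : x ∈ moved (restrictTo f N)) :
    restrictTo f N x = f x := by
  rw [mem_moved_restrictTo] at hx
  simp [restrictTo, hx.1, hx.2.1]

/-- Removing one edge from a matching. -/
theorem IsMatchingMap.exists_erase (hf : IsMatchingMap G f) (a : V) :
    ∃ g, IsMatchingMap G g ∧ moved g = moved f \ {a, f a} ∧ ∀ x ∈ moved g, g x = f x := by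
  refine ⟨_root_.restrictTo f (moved f \ {a, f a}), hf.restrictTo _, ?_,
    fun x hx => restrictTo_apply hx⟩
  ext x
  rw [mem_moved_restrictTo]
  have h1 := hf.invol x
  have h2 := hf.invol a
  simp only [Finset.mem_sdiff, mem_moved, Finset.mem_insert, Finset.mem_singleton] at *
  grind

theorem IsMatchingMap.card_erase (hf : IsMatchingMap G f) {a : V} (ha : a ∈ moved f) :
    (moved f \ {a, f a}).card + 2 = (moved f).card := by
  have h2 : ({a, f a} : Finset V).card = 2 := Finset.card_pair (mem_moved.1 ha).symm
  rw [← h2, Finset.card_sdiff_add_card_eq_card]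
  intro x hx
  rcases Finset.mem_insert.1 hx with rfl | hx
  · exact ha
  · rw [Finset.mem_singleton.1 hx]; exact hf.map_mem_moved ha

/-- A matching with at least `m` edges contains one with exactly `m` edges. -/
theorem IsMatchingMap.exists_trim (hf : IsMatchingMap G f) {m : ℕ} (hm : 2 * m ≤ (moved f).card) :
    ∃ g, IsMatchingMap G g ∧ moved g ⊆ moved f ∧ (moved g).card = 2 * m := by
  induction h : (moved f).card using Nat.strong_induction_on generalizing f with
  | _ n ih =>
    rcases eq_or_ne (moved f).card (2 * m) with he | hne
    · exact ⟨f, hf, subset_rfl, he⟩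
    obtain ⟨c, hc⟩ := hf.even_card_moved
    obtain ⟨a, ha⟩ : (moved f).Nonempty := Finset.card_pos.1 (by omega)
    obtain ⟨g, hg, hgm, -⟩ := hf.exists_erase a
    have := hf.card_erase ha
    rw [← hgm] at this
    obtain ⟨g', h1, h2, h3⟩ := ih _ (by omega) hg (by omega) rfl
    exact ⟨g', h1, h2.trans (hgm ▸ Finset.sdiff_subset), h3⟩

/-- Every matching with at most `j` edges inside `S` extends to a perfect matching of `S`. -/
def ExtendsOn (G : SimpleGraph V) (S : Finset V) (j : ℕ) : Prop :=
  ∀ f, IsMatchingMap G f → moved f ⊆ S → (moved f).card ≤ 2 * j →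
    ∃ p, IsMatchingMap G p ∧ moved p = S ∧ ∀ x ∈ moved f, p x = f x

/-- The graph induced on `S` is connected: every proper nonempty part of `S` sends out an edge. -/
def ConnectedOn (G : SimpleGraph V) (S : Finset V) : Prop :=
  ∀ C ⊆ S, C.Nonempty → (S \ C).Nonempty → ∃ a ∈ C, ∃ b ∈ S \ C, G.Adj a b

/-- The graph induced on `S` is bipartite. -/
def BipartiteOn (G : SimpleGraph V) (S : Finset V) : Prop :=
  ∃ c : V → Bool, ∀ x ∈ S, ∀ y ∈ S, G.Adj x y → c x ≠ c y

variable {S : Finset V} {j : ℕ}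

theorem ExtendsOn.mono (h : ExtendsOn G S j) {i : ℕ} (hij : i ≤ j) : ExtendsOn G S i :=
  fun f hf hS hc => h f hf hS (by omega)

theorem ExtendsOn.exists_one (h : ExtendsOn G S j) (hj : 1 ≤ j) {a b : V} (hab : G.Adj a b)
    (ha : a ∈ S) (hb : b ∈ S) : ∃ p, IsMatchingMap G p ∧ moved p = S ∧ p a = b := by
  have hm := moved_swap hab.ne
  obtain ⟨p, h1, h2, h3⟩ := h _ (isMatchingMap_swap hab)
    (by rw [hm]; grind) (by rw [hm, Finset.card_pair hab.ne]; omega)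
  exact ⟨p, h1, h2, by simpa using h3 a (by simp [hm])⟩

theorem ExtendsOn.exists_two (h : ExtendsOn G S j) (hj : 2 ≤ j) {a b c d : V} (hab : G.Adj a b)
    (hcd : G.Adj c d) (ha : a ∈ S) (hb : b ∈ S) (hc : c ∈ S) (hd : d ∈ S)
    (hac : a ≠ c) (had : a ≠ d) (hbc : b ≠ c) (hbd : b ≠ d) :
    ∃ p, IsMatchingMap G p ∧ moved p = S ∧ p a = b ∧ p c = d := by
  have hm := moved_swap hab.ne
  have hm' := moved_swap hcd.ne
  have hdis : Disjoint (moved (Equiv.swap a b)) (moved (Equiv.swap c d)) := by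
    rw [hm, hm', Finset.disjoint_left]; grind
  obtain ⟨p, h1, h2, h3⟩ := h _ ((isMatchingMap_swap hab).unionMap (isMatchingMap_swap hcd) hdis)
    (by rw [moved_unionMap, hm, hm']; grind)
    (by
      rw [moved_unionMap, Finset.card_union_of_disjoint hdis, hm, hm', Finset.card_pair hab.ne,
        Finset.card_pair hcd.ne]; omega)
  refine ⟨p, h1, h2, ?_, ?_⟩
  · rw [h3 a (by simp [moved_unionMap, hm]), unionMap_apply_left (by simp [hm])]; simp
  · rw [h3 c (by simp [moved_unionMap, hm']), unionMap_apply_right hdis (by simp [hm'])]; simp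

theorem ExtendsOn.delete_edge (h : ExtendsOn G S (j + 1)) {x y : V} (hxy : G.Adj x y)
    (hx : x ∈ S) (hy : y ∈ S) : ExtendsOn G (S \ {x, y}) j := by
  intro f hf hfS hfc
  have hm := moved_swap hxy.ne
  have hdis : Disjoint (moved (Equiv.swap x y)) (moved f) := by
    rw [hm, Finset.disjoint_right]; grind
  obtain ⟨p, h1, h2, h3⟩ := h _ ((isMatchingMap_swap hxy).unionMap hf hdis)
    (by rw [moved_unionMap, hm]; grind)
    (by
      rw [moved_unionMap, Finset.card_union_of_disjoint hdis, hm, Finset.card_pair hxy.ne]; omega)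
  have hpx : p x = y := by
    rw [h3 x (by simp [moved_unionMap, hm]), unionMap_apply_left (by simp [hm])]; simp
  obtain ⟨q, k1, k2, k3⟩ := h1.exists_erase x
  rw [hpx, h2] at k2
  refine ⟨q, k1, k2, fun z hz => ?_⟩
  rw [k3 z (k2 ▸ hfS hz), h3 z (by rw [moved_unionMap]; exact Finset.mem_union_right _ hz),
    unionMap_apply_right hdis hz]

end MatchingMap

section Deletion

variable {V : Type*} [Fintype V] [DecidableEq V] {G : SimpleGraph V} {S : Finset V} {j : ℕ}

theorem ConnectedOn.delete_edge (hc : ConnectedOn G S) (he : ExtendsOn G S 2) {x y : V}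
    (hxy : G.Adj x y) (hx : x ∈ S) (hy : y ∈ S) : ConnectedOn G (S \ {x, y}) := by
  intro C hCS hC hD
  by_contra! hno
  set D := (S \ {x, y}) \ C with hDdef
  have hsymm : ∀ b ∈ D, ∀ a ∈ C, ¬ G.Adj b a := fun b hb a ha h => hno a ha b hb h.symm
  have hDS : D ⊆ S \ {x, y} := Finset.sdiff_subset
  have hS : ∀ z ∈ S, z = x ∨ z = y ∨ z ∈ C ∨ z ∈ D := by
    intro z hz
    simp only [hDdef, Finset.mem_sdiff, Finset.mem_insert, Finset.mem_singleton]
    tauto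
  have hCD : ∀ z ∈ C, z ∉ D := by
    intro z hz hz'
    exact (Finset.mem_sdiff.1 hz').2 hz
  have hC' : ∀ z ∈ C, z ∈ S ∧ z ≠ x ∧ z ≠ y := by
    intro z hz; have := hCS hz; grind
  have hD' : ∀ z ∈ D, z ∈ S ∧ z ≠ x ∧ z ≠ y := by
    intro z hz; have := hDS hz; grind
  have hevenC : Even C.card := by
    obtain ⟨p, h1, h2, h3⟩ := he.exists_one (by norm_num) hxy hx hy
    refine h1.even_card fun z hz => ?_
    have hz' := hC' z hz
    have hzm : p z ≠ z := mem_moved.1 (h2 ▸ hz'.1)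
    have hpz : p z ∈ S := h2 ▸ h1.map_mem_moved (mem_moved.2 hzm)
    have := h1.adj z hzm
    have h4 := h1.invol z
    have h5 := h1.invol x
    refine ⟨?_, hzm⟩
    rcases hS _ hpz with h | h | h | h
    · grind
    · grind
    · exact h
    · exact absurd this (hno _ hz _ h)
  -- the two ends of the edge cannot reach different sides
  have hcross : ∀ u v : V, u ∈ S → v ∈ S → u ≠ v → (∀ z ∈ S, z = u ∨ z = v ∨ z ∈ C ∨ z ∈ D) →
      (∀ z ∈ C, z ≠ u ∧ z ≠ v) → (∀ z ∈ D, z ≠ u ∧ z ≠ v) →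
      ∀ c ∈ C, ∀ d ∈ D, G.Adj u c → ¬ G.Adj v d := by
    intro u v hu hv huv hSuv hCuv hDuv c hcC d hdD huc hvd
    obtain ⟨p, h1, h2, h3, h4⟩ := he.exists_two le_rfl huc hvd hu (hC' c hcC).1 hv (hD' d hdD).1
      huv (hDuv d hdD).1.symm (hCuv c hcC).2 (fun h => hCD c hcC (h ▸ hdD))
    have : Even (C.erase c).card := by
      refine h1.even_card fun z hz => ?_
      have hzc := Finset.ne_of_mem_erase hz
      have hz := Finset.mem_of_mem_erase hz
      have hz' := hC' z hz
      have hzm : p z ≠ z := mem_moved.1 (h2 ▸ hz'.1)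
      have hpz : p z ∈ S := h2 ▸ h1.map_mem_moved (mem_moved.2 hzm)
      have hadj := h1.adj z hzm
      have k1 := h1.invol z
      have k2 := h1.invol u
      have k3 := h1.invol v
      refine ⟨?_, hzm⟩
      rcases hSuv _ hpz with h | h | h | h
      · grind
      · exfalso
        have : z = d := by rw [← k1, h, h4]
        exact hCD z hz (this ▸ hdD)
      · refine Finset.mem_erase.2 ⟨fun h' => ?_, h⟩
        have : z = u := by rw [← k1, h', ← h3, k2]
        exact (hCuv z hz).1 this
      · exact absurd hadj (hno _ hz _ h)
    rw [Finset.card_erase_of_mem hcC] at this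
    have := Finset.card_pos.2 hC
    grind
  have hiso : ∀ u v : V, u ∈ S → v ∈ S → u ≠ v → (∀ z ∈ S, z = u ∨ z = v ∨ z ∈ C ∨ z ∈ D) →
      (∀ z ∈ C, z ≠ u ∧ z ≠ v) → (∃ c ∈ C, G.Adj u c) → (∀ z ∈ C, ¬ G.Adj v z) →
      (∀ z ∈ D, ¬ G.Adj v z) → False := by
    rintro u v hu hv huv hSuv hCuv ⟨c, hcC, huc⟩ hvC hvD
    obtain ⟨p, h1, h2, h3⟩ := he.exists_one (by norm_num) huc hu (hC' c hcC).1
    have hzm : p v ≠ v := mem_moved.1 (h2 ▸ hv)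
    have hpz : p v ∈ S := h2 ▸ h1.map_mem_moved (mem_moved.2 hzm)
    have hadj := h1.adj v hzm
    rcases hSuv _ hpz with h | h | h | h
    · have : v = c := by rw [← h1.invol v, h, h3]
      exact (hCuv c hcC).2 this.symm
    · exact hzm h
    · exact hvC _ h hadj
    · exact hvD _ h hadj
  obtain ⟨c, hcC, c', hc', hcc'⟩ := hc C (hCS.trans Finset.sdiff_subset) hC ⟨x, by grind⟩
  obtain ⟨d, hdD, d', hd', hdd'⟩ := hc D (hDS.trans Finset.sdiff_subset) hD ⟨x, by grind⟩
  have hSyx : ∀ z ∈ S, z = y ∨ z = x ∨ z ∈ C ∨ z ∈ D := fun z hz => by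
    have := hS z hz; tauto
  have hCx : ∀ z ∈ C, z ≠ x ∧ z ≠ y := fun z hz => (hC' z hz).2
  have hDx : ∀ z ∈ D, z ≠ x ∧ z ≠ y := fun z hz => (hD' z hz).2
  have hCy : ∀ z ∈ C, z ≠ y ∧ z ≠ x := fun z hz => (hC' z hz).2.symm
  have hDy : ∀ z ∈ D, z ≠ y ∧ z ≠ x := fun z hz => (hD' z hz).2.symm
  have hX := hcross x y hx hy hxy.ne hS hCx hDx
  have hY := hcross y x hy hx hxy.ne' hSyx hCy hDy
  have hdd : d' = x ∨ d' = y := by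
    have h1 := hS d' (Finset.mem_sdiff.1 hd').1
    have h2 := (Finset.mem_sdiff.1 hd').2
    have h3 := hsymm d hdD d'
    tauto
  have hcc : c' = x ∨ c' = y := by
    have h1 := hS c' (Finset.mem_sdiff.1 hc').1
    have h2 := (Finset.mem_sdiff.1 hc').2
    have h3 := hno c hcC d'
    have h3 := hno c hcC c'
    tauto
  rcases hcc with rfl | rfl
  · have hyD : ∀ z ∈ D, ¬ G.Adj y z := fun z hz => hX c hcC z hz hcc'.symm
    have hxd : G.Adj c' d := by
      rcases hdd with rfl | rfl
      · exact hdd'.symm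
      · exact absurd hdd'.symm (hyD d hdD)
    exact hiso c' y hx hy hxy.ne hS hCx ⟨c, hcC, hcc'.symm⟩
      (fun z hz h => hY z hz d hdD h hxd) hyD
  · have hxD : ∀ z ∈ D, ¬ G.Adj x z := fun z hz => hY c hcC z hz hcc'.symm
    have hyd : G.Adj c' d := by
      rcases hdd with rfl | rfl
      · exact absurd hdd'.symm (hxD d hdD)
      · exact hdd'.symm
    exact hiso c' x hy hx hxy.ne' hSyx hCy ⟨c, hcC, hcc'.symm⟩
      (fun z hz h => hX z hz d hdD h hyd) hxD

theorem ConnectedOn.exists_adj_neighbor (hc : ConnectedOn G S) {v : V} (hv : v ∈ S)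
    {N : Finset V} (hNS : N.card + 1 < S.card) (hN : ∀ z ∈ S, G.Adj v z → z ∈ N) :
    ∃ x ∈ N, ∃ y ∈ S, x ∈ S ∧ x ≠ v ∧ y ≠ v ∧ G.Adj x y := by
  classical
  set N' := N.filter fun z => z ∈ S ∧ G.Adj v z with hN'
  have hN'c : N'.card ≤ N.card := Finset.card_filter_le _ _
  have hcard : (insert v N').card ≤ N'.card + 1 := Finset.card_insert_le _ _
  obtain ⟨x, hx, y, hy, hxy⟩ := hc (insert v N') (by
      intro z hz; rw [hN'] at hz; grind) ⟨v, by simp⟩ (by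
      rw [← Finset.card_pos]
      have := Finset.le_card_sdiff (insert v N') S
      omega)
  have hyS := (Finset.mem_sdiff.1 hy).1
  have hyN := (Finset.mem_sdiff.1 hy).2
  have hyN' : ¬ G.Adj v y := fun h => hyN (by
    rw [hN']; exact Finset.mem_insert_of_mem (Finset.mem_filter.2 ⟨hN y hyS h, hyS, h⟩))
  have hxv : x ≠ v := by rintro rfl; exact hyN' hxy
  have hyv : y ≠ v := by rintro rfl; simp at hyN
  obtain ⟨hxN, hxS⟩ : x ∈ N ∧ x ∈ S := by
    rw [hN'] at hx; grind
  exact ⟨x, hxN, y, hyS, hxS, hxv, hyv, hxy⟩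

/-- In a connected graph on at least `2j + 2` vertices in which all matchings with at most `j`
edges extend to perfect matchings, every degree is at least `j + 1`. -/
theorem ExtendsOn.lt_card_of_neighbors (hj : 1 ≤ j) (hc : ConnectedOn G S) (he : ExtendsOn G S j)
    (hS : 2 * j + 2 ≤ S.card) {v : V} (hv : v ∈ S) {N : Finset V}
    (hN : ∀ z ∈ S, G.Adj v z → z ∈ N) : j < N.card := by
  induction j, hj using Nat.le_induction generalizing S N with
  | base =>
    by_contra! hNc
    obtain ⟨x, hxN, y, hyS, hxS, -, hyv, hxy⟩ := hc.exists_adj_neighbor hv (by omega) hN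
    obtain ⟨p, k1, k2, k3⟩ := he.exists_one le_rfl hxy hxS hyS
    have hm : v ∈ moved p := k2 ▸ hv
    have h2 := hN (p v) (k2 ▸ k1.map_mem_moved hm) (k1.adj v (mem_moved.1 hm))
    have h3 := Finset.card_le_one.1 hNc _ h2 _ hxN
    exact hyv (by rw [← k3, ← h3, k1.invol])
  | succ j hj ih =>
    by_contra! hNc
    obtain ⟨x, hxN, y, hyS, hxS, hxv, hyv, hxy⟩ := hc.exists_adj_neighbor hv (by omega) hN
    have h2 : ({x, y} : Finset V).card = 2 := Finset.card_pair hxy.ne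
    have := Finset.le_card_sdiff {x, y} S
    have h3 := ih (hc.delete_edge (he.mono (by omega)) hxy hxS hyS) (he.delete_edge hxy hxS hyS)
      (by omega) (by grind) (N := N.erase x) (by
        intro z hz hvz
        have := hN z; grind)
    rw [Finset.card_erase_of_mem hxN] at h3
    omega

end Deletion

section Barrier

variable {V : Type*} [Fintype V] [DecidableEq V] {G : SimpleGraph V} {S : Finset V} {j : ℕ}

/-- A perfect matching of the graph induced on `S`, described by an involution of `V`. -/
theorem exists_isMatchingMap_of_isPerfectMatching (M : (G.induce (S : Set V)).Subgraph)
    (hM : M.IsPerfectMatching) : ∃ p, IsMatchingMap G p ∧ moved p = S := by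
  have h : ∀ v : (S : Set V), ∃! w, M.Adj v w := Subgraph.isPerfectMatching_iff.1 hM
  choose q hq hu using h
  have hqq : ∀ v : (S : Set V), q (q v) = v := fun v => ((hu (q v)) v (hq v).symm).symm
  have hadj : ∀ v : (S : Set V), G.Adj v (q v) := fun v => by simpa using (hq v).adj_sub
  refine ⟨fun x => if hx : x ∈ (S : Set V) then (q ⟨x, hx⟩ : V) else x, ⟨?_, ?_⟩, ?_⟩
  · intro x
    by_cases hx : x ∈ (S : Set V)
    · have : (q ⟨x, hx⟩ : V) ∈ (S : Set V) := (q ⟨x, hx⟩).2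
      simp only [hx, this, dite_true, Subtype.coe_eta, hqq]
    · simp [hx]
  · intro x
    by_cases hx : x ∈ (S : Set V)
    · intro _
      simp only [hx, dite_true]
      exact hadj ⟨x, hx⟩
    · simp [hx]
  · ext x
    rw [mem_moved]
    by_cases hx : x ∈ (S : Set V)
    · simp only [hx, dite_true, ne_eq]
      exact ⟨fun _ => hx, fun _ => (hadj ⟨x, hx⟩).ne'⟩
    · simp only [hx, dite_false]
      simpa using hx

/-- Tutte's theorem for the graph induced on `S`. -/
theorem exists_odd_family (h : ¬ ∃ p, IsMatchingMap G p ∧ moved p = S) :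
    ∃ T ⊆ S, ∃ 𝒞 : Finset (Finset V), T.card < 𝒞.card ∧
      (∀ C ∈ 𝒞, Odd C.card ∧ C ⊆ S \ T ∧ ∀ a ∈ C, ∀ b ∈ S \ T, G.Adj a b → b ∈ C) ∧
      ∀ C ∈ 𝒞, ∀ D ∈ 𝒞, C ≠ D → Disjoint C D := by
  classical
  have hnot : ¬ ∃ M : (G.induce (S : Set V)).Subgraph, M.IsPerfectMatching :=
    fun ⟨M, hM⟩ => h (exists_isMatchingMap_of_isPerfectMatching M hM)
  rw [tutte] at hnot
  push Not at hnot
  obtain ⟨u, hu⟩ := hnot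
  set H := ((⊤ : (G.induce (S : Set V)).Subgraph).deleteVerts u) with hH
  have hu' : u.ncard < H.coe.oddComponents.ncard := hu
  let e : H.verts ↪ V :=
    ⟨fun y => y.1.1, fun a b hab => Subtype.ext (Subtype.ext hab)⟩
  let K : H.coe.ConnectedComponent → Finset V := fun c => c.supp.toFinset.map e
  have hK : ∀ c x, x ∈ K c ↔ ∃ y : H.verts, H.coe.connectedComponentMk y = c ∧ y.1.1 = x := by
    intro c x
    simp only [K, Finset.mem_map, Set.mem_toFinset, ConnectedComponent.mem_supp_iff]
    rfl
  have hKcard : ∀ c, (K c).card = c.supp.ncard := fun c => by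
    simp [K, Set.ncard_eq_toFinset_card']
  have hdisj : ∀ c d x, x ∈ K c → x ∈ K d → c = d := by
    intro c d x hc hd
    obtain ⟨y, rfl, hy⟩ := (hK c x).1 hc
    obtain ⟨z, rfl, hz⟩ := (hK d x).1 hd
    rw [e.injective (show e y = e z from hy.trans hz.symm)]
  have hne : ∀ c, (K c).Nonempty := by
    intro c
    obtain ⟨y, hy⟩ := c.exists_rep
    exact ⟨y.1.1, (hK c _).2 ⟨y, hy, rfl⟩⟩
  have hinj : Function.Injective K := by
    intro c d hcd
    obtain ⟨x, hx⟩ := hne c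
    exact hdisj c d x hx (hcd ▸ hx)
  have hmemT : ∀ x (hx : x ∈ (S : Set V)),
      x ∈ u.toFinset.map (Function.Embedding.subtype _) ↔ ⟨x, hx⟩ ∈ u := by
    intro x hx
    simp only [Finset.mem_map, Set.mem_toFinset, Function.Embedding.subtype_apply]
    exact ⟨fun ⟨y, hy, h⟩ => by subst h; exact hy, fun h => ⟨_, h, rfl⟩⟩
  have hverts : ∀ y : (S : Set V), y ∈ H.verts ↔ y ∉ u := by
    intro y; simp [hH]
  refine ⟨u.toFinset.map (Function.Embedding.subtype _), ?_,
    H.coe.oddComponents.toFinset.map ⟨K, hinj⟩, ?_, ?_, ?_⟩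
  · intro x hx
    obtain ⟨y, -, rfl⟩ := Finset.mem_map.1 hx
    exact y.2
  · rw [Finset.card_map, Finset.card_map, ← Set.ncard_eq_toFinset_card',
      ← Set.ncard_eq_toFinset_card']
    exact hu'
  · intro C hC
    obtain ⟨c, hc, rfl⟩ := Finset.mem_map.1 hC
    rw [Set.mem_toFinset] at hc
    refine ⟨by rw [Function.Embedding.coeFn_mk, hKcard]; exact hc, ?_, ?_⟩
    · intro x hx
      obtain ⟨y, -, rfl⟩ := (hK c x).1 hx
      exact Finset.mem_sdiff.2 ⟨y.1.2, fun h => (hverts y.1).1 y.2 ((hmemT _ y.1.2).1 h)⟩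
    · intro a ha b hb hab
      obtain ⟨y, hy, rfl⟩ := (hK c a).1 ha
      obtain ⟨hbS, hbT⟩ := Finset.mem_sdiff.1 hb
      have hbu := fun h => hbT ((hmemT b hbS).2 h)
      let z : H.verts := ⟨⟨b, hbS⟩, (hverts _).2 hbu⟩
      have hyz : H.coe.Adj y z :=
        Subgraph.deleteVerts_adj.2 ⟨trivial, (hverts _).1 y.2, trivial, hbu, hab⟩
      exact (hK c b).2 ⟨z, by
        rw [← hy]; exact (ConnectedComponent.connectedComponentMk_eq_of_adj hyz).symm, rfl⟩
  · intro C hC D hD hCD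
    obtain ⟨c, hc, rfl⟩ := Finset.mem_map.1 hC
    obtain ⟨d, hd, rfl⟩ := Finset.mem_map.1 hD
    rw [Finset.disjoint_left]
    intro x hx hx'
    exact hCD (congrArg K (hdisj c d x hx hx'))

/-- A barrier with at least two vertices forces a connected graph whose matchings with at most two
edges extend to be bipartite. -/
theorem ExtendsOn.bipartiteOn_of_barrier (hc : ConnectedOn G S) (he : ExtendsOn G S 2)
    {T : Finset V} (hTS : T ⊆ S) (hT : 2 ≤ T.card) {𝒞 : Finset (Finset V)}
    (hcard : T.card ≤ 𝒞.card)
    (h𝒞 : ∀ C ∈ 𝒞, Odd C.card ∧ C ⊆ S \ T ∧ ∀ a ∈ C, ∀ b ∈ S \ T, G.Adj a b → b ∈ C)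
    (hdisj : ∀ C ∈ 𝒞, ∀ D ∈ 𝒞, C ≠ D → Disjoint C D) : BipartiteOn G S := by
  obtain ⟨t0, ht0⟩ : T.Nonempty := Finset.card_pos.1 (by omega)
  have : Nonempty V := ⟨t0⟩
  have hCS : ∀ C ∈ 𝒞, ∀ x ∈ C, x ∈ S ∧ x ∉ T := fun C hC x hx =>
    Finset.mem_sdiff.1 ((h𝒞 C hC).2.1 hx)
  have hcl : ∀ C ∈ 𝒞, ∀ a ∈ C, ∀ b ∈ S, G.Adj a b → b ∉ C → b ∈ T := by
    intro C hC a ha b hb hab hbC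
    by_contra hbT
    exact hbC ((h𝒞 C hC).2.2 a ha b (Finset.mem_sdiff.2 ⟨hb, hbT⟩) hab)
  have key : ∀ p, IsMatchingMap G p → moved p = S →
      (∀ C ∈ 𝒞, ∀ x ∈ C, ∀ y ∈ C, p x ∈ T → p y ∈ T → x = y) ∧
      ∀ t ∈ T, ∃ C ∈ 𝒞, p t ∈ C := by
    intro p hp hpS
    have hex : ∀ C ∈ 𝒞, ∃ x ∈ C, p x ∈ T := by
      intro C hC
      by_contra! hno
      refine Nat.not_even_iff_odd.2 (h𝒞 C hC).1 (hp.even_card fun x hx => ?_)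
      have hxm : x ∈ moved p := hpS ▸ (hCS C hC x hx).1
      refine ⟨?_, mem_moved.1 hxm⟩
      by_contra hpx
      exact hno x hx (hcl C hC x hx _ (hpS ▸ hp.map_mem_moved hxm) (hp.adj x (mem_moved.1 hxm)) hpx)
    choose! q hq hqT using hex
    have heq : ∀ C ∈ 𝒞, ∀ D ∈ 𝒞, ∀ x ∈ C, x ∈ D → C = D := by
      intro C hC D hD x hx hx'
      by_contra hne
      exact Finset.disjoint_left.1 (hdisj C hC D hD hne) hx hx'
    have himg : 𝒞.image (fun C => p (q C)) = T := by
      refine Finset.eq_of_subset_of_card_le ?_ ?_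
      · intro t ht
        obtain ⟨C, hC, rfl⟩ := Finset.mem_image.1 ht
        exact hqT C hC
      · rw [Finset.card_image_of_injOn]
        · exact hcard
        · intro C hC D hD hCD
          have := hp.injective hCD
          exact heq C hC D hD _ (hq C hC) (this ▸ hq D hD)
    have hsur : ∀ t ∈ T, ∃ C ∈ 𝒞, p (q C) = t := by
      intro t ht
      rw [← himg] at ht
      simpa using ht
    refine ⟨?_, ?_⟩
    · have huniq : ∀ C ∈ 𝒞, ∀ x ∈ C, p x ∈ T → x = q C := by
        intro C hC x hx hxT
        obtain ⟨D, hD, hDx⟩ := hsur _ hxT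
        have := hp.injective hDx
        rw [heq C hC D hD x hx (this ▸ hq D hD), this]
      intro C hC x hx y hy hxT hyT
      rw [huniq C hC x hx hxT, huniq C hC y hy hyT]
    · intro t ht
      obtain ⟨C, hC, rfl⟩ := hsur t ht
      exact ⟨C, hC, by rw [hp.invol]; exact hq C hC⟩
  have hTadj : ∀ t ∈ T, ∀ b ∈ S, G.Adj t b → ∃ C ∈ 𝒞, b ∈ C := by
    intro t ht b hb htb
    obtain ⟨p, h1, h2, h3⟩ := he.exists_one (by norm_num) htb (hTS ht) hb
    simpa [h3] using (key p h1 h2).2 t ht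
  have hsing : ∀ C ∈ 𝒞, C.card ≤ 1 := by
    intro C hC
    by_contra! hC1
    have hCT : Disjoint C T := by
      rw [Finset.disjoint_left]; exact fun x hx => (hCS C hC x hx).2
    obtain ⟨a, ha, b, hb, hab⟩ := hc C (fun x hx => (hCS C hC x hx).1)
      (Finset.card_pos.1 (by omega))
      ⟨t0, Finset.mem_sdiff.2 ⟨hTS ht0, Finset.disjoint_right.1 hCT ht0⟩⟩
    obtain ⟨hbS, hbC⟩ := Finset.mem_sdiff.1 hb
    have hbT := hcl C hC a ha b hbS hab hbC
    have haS := hCS C hC a ha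
    obtain ⟨t1, ht1, ht1b⟩ := Finset.exists_mem_ne (by omega : 1 < T.card) b
    obtain ⟨c, hcC, hca⟩ := Finset.exists_mem_ne hC1 a
    obtain ⟨x, hx, y, hy, hxy⟩ := hc.delete_edge he hab haS.1 hbS (C.erase a)
      (fun z hz => by
        obtain ⟨hza, hzC⟩ := Finset.mem_erase.1 hz
        simp only [Finset.mem_sdiff, Finset.mem_insert, Finset.mem_singleton, not_or]
        exact ⟨(hCS C hC z hzC).1, hza, fun h => hbC (h ▸ hzC)⟩)
      ⟨c, Finset.mem_erase.2 ⟨hca, hcC⟩⟩ ⟨t1, by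
        simp only [Finset.mem_sdiff, Finset.mem_insert, Finset.mem_singleton, not_or,
          Finset.mem_erase, not_and]
        exact ⟨⟨hTS ht1, fun h => haS.2 (h ▸ ht1), ht1b⟩,
          fun _ => Finset.disjoint_right.1 hCT ht1⟩⟩
    have hxa := Finset.ne_of_mem_erase hx
    have hxC := Finset.mem_of_mem_erase hx
    have hyS : y ∈ S ∧ y ≠ a ∧ y ≠ b ∧ y ∉ C := by
      simp only [Finset.mem_sdiff, Finset.mem_insert, Finset.mem_singleton, not_or,
        Finset.mem_erase, not_and] at hy
      exact ⟨hy.1.1, hy.1.2.1, hy.1.2.2, hy.2 hy.1.2.1⟩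
    have hyT := hcl C hC x hxC y hyS.1 hxy hyS.2.2.2
    obtain ⟨p, h1, h2, h3, h4⟩ := he.exists_two le_rfl hab hxy haS.1 hbS (hCS C hC x hxC).1 hyS.1
      hxa.symm hyS.2.1.symm (by rintro rfl; exact hbC hxC) hyS.2.2.1.symm
    exact hxa ((key p h1 h2).1 C hC x hxC a ha (h4 ▸ hyT) (h3 ▸ hbT))
  have hcover : ∀ x ∈ S, x ∉ T → ∃ C ∈ 𝒞, x ∈ C := by
    by_contra! hno
    obtain ⟨z, hzS, hzT, hz⟩ := hno
    obtain ⟨a, ha, b, hb, hab⟩ := hc (T ∪ 𝒞.biUnion id)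
      (Finset.union_subset hTS (Finset.biUnion_subset.2 fun C hC x hx => (hCS C hC x hx).1))
      ⟨t0, Finset.mem_union_left _ ht0⟩
      ⟨z, by simp only [Finset.mem_sdiff, Finset.mem_union, Finset.mem_biUnion, id, not_or,
        not_exists, not_and]; exact ⟨hzS, hzT, hz⟩⟩
    simp only [Finset.mem_sdiff, Finset.mem_union, Finset.mem_biUnion, id, not_or] at ha hb
    rcases ha with ha | ⟨C, hC, ha⟩
    · exact hb.2.2 (hTadj a ha b hb.1 hab)
    · refine hb.2.1 (hcl C hC a ha b hb.1 hab fun h => hb.2.2 ⟨C, hC, h⟩)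
  refine ⟨fun x => decide (x ∈ T), fun x hx y hy hxy hcol => ?_⟩
  have hiff : x ∈ T ↔ y ∈ T := by simpa using hcol
  by_cases hxT : x ∈ T
  · obtain ⟨C, hC, hyC⟩ := hTadj x hxT y hy hxy
    exact (hCS C hC y hyC).2 (hiff.1 hxT)
  · obtain ⟨C, hC, hxC⟩ := hcover x hx hxT
    have hyC : y ∈ C := by
      by_contra h
      exact hxT (hiff.2 (hcl C hC x hxC y hy hxy h))
    exact hxy.ne (Finset.card_le_one.1 (hsing C hC) x hxC y hyC)

/-- A connected non-bipartite graph whose matchings with at most two edges extend is bicritical. -/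
theorem ExtendsOn.exists_of_not_bipartiteOn (hc : ConnectedOn G S) (he : ExtendsOn G S 2)
    (hb : ¬ BipartiteOn G S) {u w : V} (huw : u ≠ w) (hu : u ∈ S) (hw : w ∈ S) :
    ∃ p, IsMatchingMap G p ∧ moved p = S \ {u, w} := by
  by_contra hno
  obtain ⟨T, hT, 𝒞, hcard, h𝒞, hdisj⟩ := exists_odd_family hno
  obtain ⟨p₀, hp₀, hp₀S, -⟩ := he id IsMatchingMap.id (by simp [moved_id]) (by simp [moved_id])
  have hSeven : Even S.card := hp₀S ▸ hp₀.even_card_moved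
  have hpair : ({u, w} : Finset V).card = 2 := Finset.card_pair huw
  have hTdisj : Disjoint {u, w} T := by
    rw [Finset.disjoint_right]
    intro x hx
    exact (Finset.mem_sdiff.1 (hT hx)).2
  have hTcard : ({u, w} ∪ T).card = T.card + 2 := by
    rw [Finset.card_union_of_disjoint hTdisj, hpair, add_comm]
  have hTS : {u, w} ∪ T ⊆ S := by
    intro x hx
    simp only [Finset.mem_union, Finset.mem_insert, Finset.mem_singleton] at hx
    rcases hx with (rfl | rfl) | hx
    exacts [hu, hw, (Finset.mem_sdiff.1 (hT hx)).1]
  rw [sdiff_sdiff_left] at h𝒞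
  rw [← Finset.sup_eq_union] at hTcard hTS
  set T₁ := ({u, w} : Finset V) ⊔ T
  rcases le_or_gt T₁.card 𝒞.card with h | h
  · exact hb (he.bipartiteOn_of_barrier hc hTS (by omega) h h𝒞 hdisj)
  set R := (S \ T₁) \ 𝒞.biUnion id with hR
  have hUS : 𝒞.biUnion id ⊆ S \ T₁ := Finset.biUnion_subset.2 fun C hC => (h𝒞 C hC).2.1
  have h1 := Finset.card_sdiff_add_card_eq_card hUS
  have h2 := Finset.card_sdiff_add_card_eq_card hTS
  have h3 : (𝒞.biUnion id).card = ∑ C ∈ 𝒞, C.card := Finset.card_biUnion hdisj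
  have h4 : Odd (∑ C ∈ 𝒞, C.card) ↔ Odd 𝒞.card := by
    rw [Finset.odd_sum_iff_odd_card_odd, Finset.filter_true_of_mem fun C hC => (h𝒞 C hC).1]
  have hRodd : Odd R.card := by
    rw [← h3] at h4
    rw [← hR] at h1
    have h5 : 𝒞.card = T.card + 1 := by omega
    rw [h5] at h4
    grind
  have hRdisj : ∀ C ∈ 𝒞, Disjoint R C := by
    intro C hC
    rw [Finset.disjoint_left]
    intro x hx hxC
    exact (Finset.mem_sdiff.1 hx).2 (Finset.mem_biUnion.2 ⟨C, hC, hxC⟩)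
  have hR𝒞 : R ∉ 𝒞 := by
    intro h
    have := hRdisj R h
    rw [disjoint_self, Finset.bot_eq_empty] at this
    simp [this] at hRodd
  refine hb (he.bipartiteOn_of_barrier hc hTS (by omega) (𝒞 := insert R 𝒞)
    (by rw [Finset.card_insert_of_notMem hR𝒞]; omega) ?_ ?_)
  · intro C hC
    rcases Finset.mem_insert.1 hC with rfl | hC
    · refine ⟨hRodd, Finset.sdiff_subset, fun a ha b hb hab => ?_⟩
      refine Finset.mem_sdiff.2 ⟨hb, fun h => ?_⟩
      obtain ⟨D, hD, hbD⟩ := Finset.mem_biUnion.1 h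
      obtain ⟨haS, haU⟩ := Finset.mem_sdiff.1 ha
      exact haU (Finset.mem_biUnion.2 ⟨D, hD, (h𝒞 D hD).2.2 b hbD a haS hab.symm⟩)
    · exact h𝒞 C hC
  · intro C hC D hD hCD
    rcases Finset.mem_insert.1 hC with rfl | hC <;> rcases Finset.mem_insert.1 hD with rfl | hD
    · exact absurd rfl hCD
    · exact hRdisj D hD
    · exact (hRdisj C hC).symm
    · exact hdisj C hC D hD hCD

end Barrier

section MinDegree

variable {V : Type*} [Fintype V] [DecidableEq V] {G : SimpleGraph V} {S : Finset V} {j k : ℕ}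

theorem ExtendsOn.color_ne_of_sdiff_edge (he : ExtendsOn G S 2) {x y : V} (hxy : G.Adj x y)
    (hx : x ∈ S) (hy : y ∈ S) {c : V → Bool}
    (hcol : ∀ a ∈ S \ {x, y}, ∀ b ∈ S \ {x, y}, G.Adj a b → c a ≠ c b) {u w : V}
    (hu : u ∈ S \ {x, y}) (hw : w ∈ S \ {x, y}) (huw : u ≠ w) (hxu : G.Adj x u)
    (hyw : G.Adj y w) : c u ≠ c w := by
  intro heq
  have hmem : ∀ z, z ∈ S \ {x, y} ↔ z ∈ S ∧ z ≠ x ∧ z ≠ y := by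
    intro z; simp
  obtain ⟨huS, hux, huy⟩ := (hmem u).1 hu
  obtain ⟨hwS, hwx, hwy⟩ := (hmem w).1 hw
  set A := (S \ {x, y}).filter fun z => c z = c u with hA
  set B := (S \ {x, y}).filter fun z => ¬ c z = c u with hB
  obtain ⟨q, hq, hqS, -⟩ := (he.delete_edge (j := 1) hxy hx hy) id IsMatchingMap.id
    (by simp [moved_id]) (by simp [moved_id])
  have h1 : A.card ≤ B.card := by
    refine Finset.card_le_card_of_injOn q ?_ hq.injective.injOn
    intro z hz
    obtain ⟨hzS, hzc⟩ := Finset.mem_filter.1 hz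
    have hqz : q z ∈ S \ {x, y} := hqS ▸ hq.map_mem_moved (hqS ▸ hzS)
    have := hcol z hzS _ hqz (hq.adj z (mem_moved.1 (hqS ▸ hzS)))
    exact Finset.mem_filter.2 ⟨hqz, fun h => this (hzc.trans h.symm)⟩
  obtain ⟨p, hp, hpS, hpx, hpy⟩ := he.exists_two le_rfl hxu hyw hx huS hy hwS hxy.ne hwx.symm
    huy huw
  have hpu : p u = x := by rw [← hpx, hp.invol]
  have hpw : p w = y := by rw [← hpy, hp.invol]
  have h2 : B.card ≤ (A \ {u, w}).card := by
    refine Finset.card_le_card_of_injOn p ?_ hp.injective.injOn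
    intro z hz
    obtain ⟨hzS, hzc⟩ := Finset.mem_filter.1 hz
    obtain ⟨hzS', hzx, hzy⟩ := (hmem z).1 hzS
    have hpzS : p z ∈ S := hpS ▸ hp.map_mem_moved (hpS ▸ hzS')
    have hpz : p z ∈ S \ {x, y} := by
      refine (hmem _).2 ⟨hpzS, fun h => ?_, fun h => ?_⟩
      · exact hzc (by rw [hp.injective (h.trans hpu.symm)])
      · exact hzc (by rw [hp.injective (h.trans hpw.symm), heq])
    have hne := hcol z hzS _ hpz (hp.adj z (mem_moved.1 (hpS ▸ hzS')))
    rw [Finset.mem_coe, Finset.mem_sdiff, Finset.mem_insert, Finset.mem_singleton, not_or]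
    refine ⟨Finset.mem_filter.2 ⟨hpz, ?_⟩, fun h => ?_, fun h => ?_⟩
    · revert hne hzc
      generalize c z = α; generalize c (p z) = β; generalize c u = γ
      revert α β γ; decide
    · exact hzx (hp.injective (h.trans hpx.symm))
    · exact hzy (hp.injective (h.trans hpy.symm))
  have h3 : ({u, w} : Finset V) ⊆ A := by
    intro z hz
    rcases Finset.mem_insert.1 hz with rfl | hz
    · exact Finset.mem_filter.2 ⟨hu, rfl⟩
    · rw [Finset.mem_singleton.1 hz]; exact Finset.mem_filter.2 ⟨hw, heq.symm⟩
  have h4 := Finset.card_sdiff_add_card_eq_card h3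
  rw [Finset.card_pair huw] at h4
  omega

/-- Deleting the ends of an edge from a graph whose matchings with at most three edges extend
does not create bipartite graphs. -/
theorem ExtendsOn.bipartiteOn_of_sdiff_edge (hc : ConnectedOn G S) (he : ExtendsOn G S 3)
    (hS : 8 ≤ S.card) {x y : V} (hxy : G.Adj x y) (hx : x ∈ S) (hy : y ∈ S)
    (hb : BipartiteOn G (S \ {x, y})) : BipartiteOn G S := by
  classical
  obtain ⟨c, hcol⟩ := hb
  have hmem : ∀ z, z ∈ S \ {x, y} ↔ z ∈ S ∧ z ≠ x ∧ z ≠ y := by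
    intro z; simp
  have hdeg : ∀ v w : V, v ∈ S → ({v, w} : Finset V) = {x, y} →
      2 < ((S \ {x, y}).filter (G.Adj v)).card := by
    intro v w hv hvw
    have := he.lt_card_of_neighbors (by norm_num) hc (by omega) hv
      (N := insert w ((S \ {x, y}).filter (G.Adj v))) (by
        intro z hz hvz
        rw [← hvw]
        rcases eq_or_ne z w with rfl | hzw
        · exact Finset.mem_insert_self _ _
        · refine Finset.mem_insert_of_mem (Finset.mem_filter.2 ⟨?_, hvz⟩)
          simp [hz, hvz.ne', hzw])
    have := Finset.card_insert_le w ((S \ {x, y}).filter (G.Adj v))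
    omega
  have hdx := hdeg x y hx rfl
  have hdy := hdeg y x hy (Finset.pair_comm _ _)
  have he2 := he.mono (by norm_num : 2 ≤ 3)
  set X := (S \ {x, y}).filter (G.Adj x) with hX
  set Y := (S \ {x, y}).filter (G.Adj y) with hY
  have hne : ∀ u ∈ X, ∀ w ∈ Y, u ≠ w → c u ≠ c w := by
    intro u hu w hw huw
    obtain ⟨hu, hxu⟩ := Finset.mem_filter.1 hu
    obtain ⟨hw, hyw⟩ := Finset.mem_filter.1 hw
    exact he2.color_ne_of_sdiff_edge hxy hx hy hcol hu hw huw hxu hyw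
  have hmono : ∀ A B : Finset V, 2 < B.card → (∀ u ∈ A, ∀ w ∈ B, u ≠ w → c u ≠ c w) →
      ∀ u ∈ A, ∀ v ∈ A, c u = c v := by
    intro A B hB h u hu v hv
    obtain ⟨w, hw, hwn⟩ := Finset.exists_mem_notMem_of_card_lt_card
      (lt_of_le_of_lt (Finset.card_le_two (a := u) (b := v)) hB)
    simp only [Finset.mem_insert, Finset.mem_singleton, not_or] at hwn
    have h1 := h u hu w hw (Ne.symm hwn.1)
    have h2 := h v hv w hw (Ne.symm hwn.2)
    revert h1 h2
    generalize c u = α; generalize c v = β; generalize c w = γ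
    revert α β γ; decide
  have hXm := hmono X Y hdy hne
  have hYm := hmono Y X hdx fun u hu w hw h => (hne w hw u hu h.symm).symm
  obtain ⟨u, hu⟩ : X.Nonempty := Finset.card_pos.1 (by omega)
  obtain ⟨w, hw, hwu⟩ := Finset.exists_mem_ne (by omega : 1 < Y.card) u
  have huw := hne u hu w hw hwu.symm
  have hxc : ∀ b ∈ S, b ≠ y → G.Adj x b → c b = c u := fun b hb hby hxb =>
    hXm b (Finset.mem_filter.2 ⟨(hmem b).2 ⟨hb, hxb.ne', hby⟩, hxb⟩) u hu
  have hyc : ∀ b ∈ S, b ≠ x → G.Adj y b → c b = c w := fun b hb hbx hyb =>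
    hYm b (Finset.mem_filter.2 ⟨(hmem b).2 ⟨hb, hbx, hyb.ne'⟩, hyb⟩) w hw
  refine ⟨fun z => if z = x then c w else if z = y then c u else c z, fun a ha b hb hab => ?_⟩
  have hyx := hxy.ne'
  have habn := hab.ne
  rcases eq_or_ne a x with rfl | hax
  · rcases eq_or_ne b y with rfl | hby
    · simpa [hyx] using huw.symm
    · simpa [habn.symm, hby, hxc b hb hby hab] using huw.symm
  rcases eq_or_ne b x with rfl | hbx
  · rcases eq_or_ne a y with rfl | hay
    · simpa [hyx] using huw
    · simpa [habn, hay, hxc a ha hay hab.symm] using huw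
  rcases eq_or_ne a y with rfl | hay
  · simpa [hyx, hbx, habn.symm, hyc b hb hbx hab] using huw
  rcases eq_or_ne b y with rfl | hby
  · simpa [hyx, hax, habn, hyc a ha hax hab.symm] using huw.symm
  simpa [hax, hay, hbx, hby] using hcol a ((hmem a).2 ⟨ha, hax, hay⟩) b ((hmem b).2 ⟨hb, hbx, hby⟩)
    hab

/-- Deleting the vertices of a matching with `m` edges. -/
theorem ExtendsOn.sdiff_moved {m : ℕ} (hj : 1 ≤ j) (hc : ConnectedOn G S)
    (he : ExtendsOn G S (j + m)) (hS : 2 * (j + m) + 2 ≤ S.card) {f : V → V}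
    (hf : IsMatchingMap G f) (hfS : moved f ⊆ S) (hfc : (moved f).card = 2 * m) :
    ConnectedOn G (S \ moved f) ∧ ExtendsOn G (S \ moved f) j ∧
      (2 ≤ j → BipartiteOn G (S \ moved f) → BipartiteOn G S) := by
  induction m generalizing S f with
  | zero =>
    have : moved f = ∅ := Finset.card_eq_zero.1 (by omega)
    rw [this, Finset.sdiff_empty]
    exact ⟨hc, he, fun _ h => h⟩
  | succ m ih =>
    obtain ⟨a, ha⟩ : (moved f).Nonempty := Finset.card_pos.1 (by omega)
    obtain ⟨g, hg, hgm, -⟩ := hf.exists_erase a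
    have hcard := hf.card_erase ha
    have hadj := hf.adj a (mem_moved.1 ha)
    have haS := hfS ha
    have hbS := hfS (hf.map_mem_moved ha)
    have hsub : {a, f a} ⊆ moved f := by
      intro z hz
      rcases Finset.mem_insert.1 hz with rfl | hz
      · exact ha
      · rw [Finset.mem_singleton.1 hz]; exact hf.map_mem_moved ha
    have hSc := Finset.card_sdiff_add_card_eq_card (hsub.trans hfS)
    rw [Finset.card_pair hadj.ne] at hSc
    have heq : (S \ {a, f a}) \ moved g = S \ moved f := by
      rw [hgm, sdiff_sdiff_left]
      congr 1
      rw [Finset.sup_eq_union, Finset.union_sdiff_of_subset hsub]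
    obtain ⟨h1, h2, h3⟩ := ih (hc.delete_edge (he.mono (by omega)) hadj haS hbS)
      (he.delete_edge (j := j + m) hadj haS hbS) (by omega) hg
      (by rw [hgm]; exact Finset.sdiff_subset_sdiff hfS subset_rfl) (by rw [hgm]; omega)
    rw [heq] at h1 h2 h3
    exact ⟨h1, h2, fun hj2 hb => (he.mono (by omega)).bipartiteOn_of_sdiff_edge hc (by omega) hadj
      haS hbS (h3 hj2 hb)⟩

/-- In a non-bipartite graph on `4k` vertices whose matchings with at most `k` edges extend, a set
of `k + t` vertices with `t < k` spans a matching with `t` edges. -/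
theorem ExtendsOn.exists_matching_subset (hV : Fintype.card V = 4 * k)
    (hc : ConnectedOn G Finset.univ) (he : ExtendsOn G Finset.univ k)
    (hb : ¬ BipartiteOn G Finset.univ) {t : ℕ} (ht : t < k) {N : Finset V}
    (hN : N.card = k + t) {m : ℕ} (hm : m ≤ t) :
    ∃ f, IsMatchingMap G f ∧ moved f ⊆ N ∧ (moved f).card = 2 * m := by
  induction m with
  | zero => exact ⟨id, IsMatchingMap.id, by simp [moved_id], by simp [moved_id]⟩
  | succ m ih =>
    obtain ⟨f, hf, hfN, hfc⟩ := ih (by omega)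
    have hkm : k = (k - m) + m := by omega
    have huniv : (Finset.univ : Finset V).card = 4 * k := by rw [Finset.card_univ, hV]
    rw [hkm] at he
    obtain ⟨h1, h2, h3⟩ := he.sdiff_moved (by omega) hc (by omega) hf (Finset.subset_univ _) hfc
    rw [← hkm] at he
    have hcN := Finset.card_sdiff_add_card_eq_card hfN
    obtain ⟨u, hu, w, hw, huw⟩ := Finset.one_lt_card.1 (show 1 < (N \ moved f).card by omega)
    obtain ⟨huN, huf⟩ := Finset.mem_sdiff.1 hu
    obtain ⟨hwN, hwf⟩ := Finset.mem_sdiff.1 hw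
    obtain ⟨p, hp, hpm⟩ := (h2.mono (by omega)).exists_of_not_bipartiteOn h1
      (fun h => hb (h3 (by omega) h)) huw (Finset.mem_sdiff.2 ⟨Finset.mem_univ _, huf⟩)
      (Finset.mem_sdiff.2 ⟨Finset.mem_univ _, hwf⟩)
    have hpmem : ∀ z, z ∈ moved p ↔ z ∉ moved f ∧ z ≠ u ∧ z ≠ w := by
      intro z
      rw [hpm]
      simp only [Finset.mem_sdiff, Finset.mem_univ, true_and, Finset.mem_insert,
        Finset.mem_singleton, not_or]
    by_cases hex : ∃ a ∈ N, a ∈ moved p ∧ p a ∈ N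
    · obtain ⟨a, haN, ha, hpa⟩ := hex
      have hadj := hp.adj a (mem_moved.1 ha)
      have hms := moved_swap hadj.ne
      have hdis : Disjoint (moved f) (moved (Equiv.swap a (p a))) := by
        rw [hms, Finset.disjoint_right]
        intro z hz
        rcases Finset.mem_insert.1 hz with rfl | hz
        · exact ((hpmem z).1 ha).1
        · rw [Finset.mem_singleton.1 hz]; exact ((hpmem _).1 (hp.map_mem_moved ha)).1
      refine ⟨_, hf.unionMap (isMatchingMap_swap hadj) hdis, ?_, ?_⟩
      · rw [moved_unionMap, hms]
        refine Finset.union_subset hfN fun z hz => ?_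
        rcases Finset.mem_insert.1 hz with rfl | hz
        · exact haN
        · rw [Finset.mem_singleton.1 hz]; exact hpa
      · rw [moved_unionMap, Finset.card_union_of_disjoint hdis, hms, Finset.card_pair hadj.ne]
        omega
    push Not at hex
    set g := restrictTo p Nᶜ with hg
    have hgM : IsMatchingMap G g := hp.restrictTo _
    have hgN : moved g ⊆ Nᶜ := moved_restrictTo_subset _
    have hNc : Nᶜ.card + N.card = 4 * k := by rw [← hV, Finset.card_compl_add_card]
    have hgc := Finset.card_sdiff_add_card_eq_card hgN
    have hsub2 : {u, w} ⊆ N \ moved f := by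
      intro z hz
      rcases Finset.mem_insert.1 hz with rfl | hz
      · exact hu
      · rw [Finset.mem_singleton.1 hz]; exact hw
    have hc2 := Finset.card_sdiff_add_card_eq_card hsub2
    rw [Finset.card_pair huw] at hc2
    have himg : ((N \ moved f) \ {u, w}).image p = Nᶜ \ moved g := by
      ext z
      simp only [Finset.mem_image, Finset.mem_sdiff, Finset.mem_compl]
      constructor
      · rintro ⟨a, ⟨⟨haN, haf⟩, hauw⟩, rfl⟩
        simp only [Finset.mem_insert, Finset.mem_singleton, not_or] at hauw
        refine ⟨hex a haN ((hpmem a).2 ⟨haf, hauw⟩), fun h => ?_⟩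
        rw [hg, mem_moved_restrictTo, hp.invol] at h
        exact Finset.mem_compl.1 h.2.1 haN
      · rintro ⟨hzN, hzg⟩
        have hzp : z ∈ moved p := (hpmem z).2 ⟨fun h => hzN (hfN h),
          fun h => hzN (h ▸ huN), fun h => hzN (h ▸ hwN)⟩
        have hpz := (hpmem _).1 (hp.map_mem_moved hzp)
        refine ⟨p z, ⟨⟨?_, hpz.1⟩, by simpa using hpz.2⟩, hp.invol z⟩
        by_contra hpzN
        exact hzg (mem_moved_restrictTo.2 ⟨Finset.mem_compl.2 hzN, Finset.mem_compl.2 hpzN, hzp⟩)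
    have hcimg := congrArg Finset.card himg
    rw [Finset.card_image_of_injective _ hp.injective] at hcimg
    obtain ⟨r, hr, hrm, hrg⟩ := he g hgM (Finset.subset_univ _) (by omega)
    have hbound : (N \ moved (restrictTo r N)).card ≤ (Nᶜ \ moved g).card := by
      refine Finset.card_le_card_of_injOn r ?_ hr.injective.injOn
      intro z hz
      obtain ⟨hzN, hzr⟩ := Finset.mem_sdiff.1 hz
      rw [mem_moved_restrictTo, hrm] at hzr
      have hrz : r z ∉ N := fun h => hzr ⟨hzN, h, Finset.mem_univ _⟩
      refine Finset.mem_coe.2 (Finset.mem_sdiff.2 ⟨Finset.mem_compl.2 hrz, fun h => ?_⟩)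
      have h4 := hgM.map_mem_moved h
      rw [← hrg _ h, hr.invol] at h4
      exact Finset.mem_compl.1 (hgN h4) hzN
    have hcr := Finset.card_sdiff_add_card_eq_card (moved_restrictTo_subset (f := r) N)
    obtain ⟨f', hf', hsub', hcard'⟩ := (hr.restrictTo N).exists_trim (m := m + 1) (by omega)
    exact ⟨f', hf', hsub'.trans (moved_restrictTo_subset _), hcard'⟩

/-- The minimum degree bound. -/
theorem ExtendsOn.two_mul_le_card_neighbors (hk : 1 ≤ k) (hV : Fintype.card V = 4 * k)
    (hc : ConnectedOn G Finset.univ) (he : ExtendsOn G Finset.univ k)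
    (hb : ¬ BipartiteOn G Finset.univ) {v : V} {N : Finset V} (hN : ∀ z, z ∈ N ↔ G.Adj v z) :
    2 * k ≤ N.card := by
  have huniv : (Finset.univ : Finset V).card = 4 * k := by rw [Finset.card_univ, hV]
  by_contra! hlt
  have hk1 := he.lt_card_of_neighbors hk hc (by omega) (Finset.mem_univ v)
    (fun z _ h => (hN z).2 h)
  obtain ⟨t, ht⟩ := Nat.exists_eq_add_of_lt hk1
  obtain ⟨f, hf, hfN, hfc⟩ := he.exists_matching_subset hV hc hb (t := t + 1) (by omega)
    (by omega : N.card = k + (t + 1)) le_rfl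
  have hkt : k = (k - (t + 1)) + (t + 1) := by omega
  rw [hkt] at he
  obtain ⟨h1, h2, -⟩ := he.sdiff_moved (by omega) hc (by omega) hf (Finset.subset_univ _) hfc
  have hcS := Finset.card_sdiff_add_card_eq_card (Finset.subset_univ (moved f))
  have hcN := Finset.card_sdiff_add_card_eq_card hfN
  have := h2.lt_card_of_neighbors (by omega) h1 (by omega) (v := v)
    (Finset.mem_sdiff.2 ⟨Finset.mem_univ _, fun h => G.loopless.irrefl v ((hN v).1 (hfN h))⟩)
    (N := N \ moved f)
    fun z hz h => Finset.mem_sdiff.2 ⟨(hN z).2 h, (Finset.mem_sdiff.1 hz).2⟩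
  omega

end MinDegree

section Subgraph

variable {V : Type*} [Fintype V] {G : SimpleGraph V} {f : V → V} {k : ℕ}

theorem SimpleGraph.Subgraph.IsMatching.ncard_verts {M : G.Subgraph} (hM : M.IsMatching) :
    M.verts.ncard = 2 * M.edgeSet.ncard := by
  classical
  have h := M.spanningCoe.sum_degrees_eq_twice_card_edges
  have hdeg : ∀ v, M.spanningCoe.degree v = if v ∈ M.verts then 1 else 0 := by
    intro v
    split_ifs with hv
    · obtain ⟨w, hw, hu⟩ := hM hv
      rw [← card_neighborFinset_eq_degree, Finset.card_eq_one]
      refine ⟨w, ?_⟩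
      ext z
      rw [mem_neighborFinset, Finset.mem_singleton]
      exact ⟨fun h => hu z h, fun h => h ▸ hw⟩
    · rw [← card_neighborFinset_eq_degree, Finset.card_eq_zero, Finset.eq_empty_iff_forall_notMem]
      intro z hz
      rw [mem_neighborFinset] at hz
      exact hv (M.edge_vert hz)
  rw [Finset.sum_congr rfl fun v _ => hdeg v, Finset.sum_boole, edgeFinset,
    ← Set.ncard_eq_toFinset_card', Subgraph.edgeSet_spanningCoe, Nat.cast_id] at h
  rw [← h, Set.ncard_eq_toFinset_card']
  congr 1
  ext; simp

theorem BipartiteOn.colorable (h : BipartiteOn G Finset.univ) : G.Colorable 2 := by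
  obtain ⟨c, hc⟩ := h
  exact (Coloring.mk c fun {x y} hxy =>
    hc x (Finset.mem_univ _) y (Finset.mem_univ _) hxy).colorable

variable [DecidableEq V]

/-- The subgraph whose edges are those of a matching given by an involution. -/
def IsMatchingMap.toSubgraph (hf : IsMatchingMap G f) : G.Subgraph where
  verts := moved f
  Adj x y := f x = y ∧ x ≠ y
  adj_sub := by
    rintro x _ ⟨rfl, h⟩
    exact hf.adj x h.symm
  edge_vert := by
    rintro x _ ⟨rfl, h⟩
    simpa using h.symm
  symm := ⟨by
    rintro x _ ⟨rfl, h⟩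
    exact ⟨hf.invol x, h.symm⟩⟩

theorem IsMatchingMap.isMatching_toSubgraph (hf : IsMatchingMap G f) :
    hf.toSubgraph.IsMatching := by
  intro x hx
  exact ⟨f x, ⟨rfl, (mem_moved.1 (Finset.mem_coe.1 hx)).symm⟩, fun y hy => hy.1.symm⟩

theorem IsMatchingMap.ncard_edgeSet_toSubgraph (hf : IsMatchingMap G f) :
    (moved f).card = 2 * hf.toSubgraph.edgeSet.ncard := by
  rw [← hf.isMatching_toSubgraph.ncard_verts, ← Set.ncard_coe_finset]
  rfl

theorem SimpleGraph.Subgraph.IsMatching.exists_isMatchingMap {M : G.Subgraph}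
    (hM : M.IsMatching) : ∃ f, ∃ hf : IsMatchingMap G f, hf.toSubgraph = M := by
  classical
  have hex : ∀ x, ∃ y, x ∈ M.verts → M.Adj x y ∧ ∀ z, M.Adj x z → z = y := by
    intro x
    by_cases hx : x ∈ M.verts
    · obtain ⟨y, hy, hu⟩ := hM hx
      exact ⟨y, fun _ => ⟨hy, hu⟩⟩
    · exact ⟨x, fun h => absurd h hx⟩
  choose q hqu using hex
  have hq := fun x hx => (hqu x hx).1
  have hu := fun x hx => (hqu x hx).2
  have hqv : ∀ x ∈ M.verts, q x ∈ M.verts := fun x hx => M.edge_vert (hq x hx).symm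
  have hqq : ∀ x ∈ M.verts, q (q x) = x := fun x hx => (hu _ (hqv x hx) x (hq x hx).symm).symm
  have hf : IsMatchingMap G fun x => if x ∈ M.verts then q x else x := by
    constructor
    · intro x
      by_cases hx : x ∈ M.verts
      · simp [hx, hqv x hx, hqq x hx]
      · simp [hx]
    · intro x
      by_cases hx : x ∈ M.verts
      · simpa [hx] using fun _ => (hq x hx).adj_sub
      · simp [hx]
  refine ⟨_, hf, Subgraph.ext ?_ ?_⟩
  · ext x
    refine Finset.mem_coe.trans (mem_moved.trans ?_)
    by_cases hx : x ∈ M.verts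
    · simpa [hx] using (hq x hx).adj_sub.ne'
    · simp [hx]
  · ext x y
    change (if x ∈ M.verts then q x else x) = y ∧ x ≠ y ↔ _
    by_cases hx : x ∈ M.verts
    · simp only [hx, if_true]
      exact ⟨fun h => h.1 ▸ hq x hx, fun h => ⟨(hu x hx y h).symm, h.adj_sub.ne⟩⟩
    · simp only [hx, if_false]
      exact ⟨fun h => absurd h.1 h.2, fun h => absurd (M.edge_vert h) hx⟩

theorem SimpleGraph.Connected.connectedOn_univ (h : G.Connected) :
    ConnectedOn G Finset.univ := by
  rintro C - ⟨a, ha⟩ ⟨b, hb⟩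
  obtain ⟨p⟩ := h.preconnected a b
  obtain ⟨d, -, h1, h2⟩ := p.exists_boundary_dart (C : Set V) ha
    (by simpa using (Finset.mem_sdiff.1 hb).2)
  exact ⟨d.fst, h1, d.snd, Finset.mem_sdiff.2 ⟨Finset.mem_univ _, h2⟩, d.adj⟩

theorem IsExtendable.extendsOn_of_card_eq (h : IsExtendable G k) {f : V → V}
    (hf : IsMatchingMap G f) (hfc : (moved f).card = 2 * k) :
    ∃ p, IsMatchingMap G p ∧ moved p = Finset.univ ∧ ∀ x ∈ moved f, p x = f x := by
  have hcard := hf.ncard_edgeSet_toSubgraph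
  obtain ⟨P, ⟨hP, hPs⟩, hle⟩ := h.2.2 hf.toSubgraph hf.isMatching_toSubgraph (by omega)
  obtain ⟨p, hp, rfl⟩ := hP.exists_isMatchingMap
  refine ⟨p, hp, Finset.eq_univ_iff_forall.2 hPs, fun x hx => ?_⟩
  exact (hle.2 (show hf.toSubgraph.Adj x (f x) from ⟨rfl, (mem_moved.1 hx).symm⟩)).1

theorem IsExtendable.extendsOn_univ (h : IsExtendable G k) (hV : Fintype.card V = 4 * k) :
    ExtendsOn G Finset.univ k := by
  obtain ⟨M₀, hM₀, hM₀c⟩ := h.2.1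
  obtain ⟨f₀, hf₀, rfl⟩ := hM₀.exists_isMatchingMap
  obtain ⟨q, hq, hqm, -⟩ := h.extendsOn_of_card_eq hf₀ (by
    have := hf₀.ncard_edgeSet_toSubgraph
    omega)
  intro f hf hfS hfc
  induction hd : 2 * k - (moved f).card using Nat.strong_induction_on generalizing f with
  | _ d ih =>
    rcases hfc.eq_or_lt with heq | hlt
    · exact h.extendsOn_of_card_eq hf heq
    have hex : ∃ a, a ∉ moved f ∧ q a ∉ moved f := by
      by_contra! hno
      have h1 : (moved f)ᶜ.card ≤ (moved f).card :=
        Finset.card_le_card_of_injOn q (fun a ha => hno a (Finset.mem_compl.1 ha))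
          hq.injective.injOn
      have h2 := Finset.card_compl_add_card (moved f)
      omega
    obtain ⟨a, ha, hqa⟩ := hex
    have hadj := hq.adj a (mem_moved.1 (hqm ▸ Finset.mem_univ a))
    have hms := moved_swap hadj.ne
    have hdis : Disjoint (moved f) (moved (Equiv.swap a (q a))) := by
      rw [hms, Finset.disjoint_right]
      intro z hz
      rcases Finset.mem_insert.1 hz with rfl | hz
      · exact ha
      · rw [Finset.mem_singleton.1 hz]; exact hqa
    have hcard : (moved (unionMap f (Equiv.swap a (q a)))).card = (moved f).card + 2 := by
      rw [moved_unionMap, Finset.card_union_of_disjoint hdis, hms, Finset.card_pair hadj.ne]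
    obtain ⟨c, hc⟩ := hf.even_card_moved
    obtain ⟨p, hp, hpm, hpe⟩ := ih _ (by omega) _ (hf.unionMap (isMatchingMap_swap hadj) hdis)
      (Finset.subset_univ _) (by omega) rfl
    refine ⟨p, hp, hpm, fun x hx => ?_⟩
    rw [hpe x (by rw [moved_unionMap]; exact Finset.mem_union_left _ hx), unionMap_apply_left hx]

theorem isExtendable_of_isMatchingMap (hc : G.Connected)
    (hk : ∃ f, IsMatchingMap G f ∧ (moved f).card = 2 * k)
    (he : ∀ f, IsMatchingMap G f → (moved f).card = 2 * k →
      ∃ g, IsMatchingMap G g ∧ moved g = (moved f)ᶜ) : IsExtendable G k := by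
  refine ⟨hc, ?_, fun M hM hMk => ?_⟩
  · obtain ⟨f, hf, hfc⟩ := hk
    have := hf.ncard_edgeSet_toSubgraph
    exact ⟨hf.toSubgraph, hf.isMatching_toSubgraph, by omega⟩
  · obtain ⟨f, hf, rfl⟩ := hM.exists_isMatchingMap
    have := hf.ncard_edgeSet_toSubgraph
    obtain ⟨g, hg, hgm⟩ := he f hf (by omega)
    have hdis : Disjoint (moved f) (moved g) := hgm ▸ disjoint_compl_right
    have hp := hf.unionMap hg hdis
    have hm : moved (unionMap f g) = Finset.univ := by
      rw [moved_unionMap, hgm, Finset.union_compl]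
    refine ⟨hp.toSubgraph, ⟨hp.isMatching_toSubgraph, fun v => ?_⟩, ?_, ?_⟩
    · exact Finset.mem_coe.2 (hm ▸ Finset.mem_univ v)
    · intro v _
      exact Finset.mem_coe.2 (hm ▸ Finset.mem_univ v)
    · rintro x y ⟨rfl, hxy⟩
      exact ⟨unionMap_apply_left (mem_moved.2 hxy.symm), hxy⟩

/-- The lower bound for the size. -/
theorem IsExtendable.four_mul_sq_le (hk : 1 ≤ k) (hV : Fintype.card V = 4 * k)
    (h : IsExtendable G k) (hcol : ¬ G.Colorable 2) : 4 * k ^ 2 ≤ G.edgeSet.ncard := by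
  classical
  have hdeg : ∀ v, 2 * k ≤ G.degree v := fun v =>
    (h.extendsOn_univ hV).two_mul_le_card_neighbors hk hV h.1.connectedOn_univ
      (fun hb => hcol hb.colorable) fun z => mem_neighborFinset _ _ _
  have hsum := G.sum_degrees_eq_twice_card_edges
  have hle : ∑ _v : V, 2 * k ≤ ∑ v, G.degree v := Finset.sum_le_sum fun v _ => hdeg v
  rw [Finset.sum_const, Finset.card_univ, hV, smul_eq_mul] at hle
  rw [Set.ncard_eq_toFinset_card', ← edgeFinset]
  nlinarith

end Subgraph

section Prism

variable {n k : ℕ}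

theorem exists_isMatchingMap_of_isClique {V : Type*} [Fintype V] [DecidableEq V]
    {G : SimpleGraph V} {A : Finset V} (hA : G.IsClique A) (he : Even A.card) :
    ∃ p, IsMatchingMap G p ∧ moved p = A := by
  induction hn : A.card using Nat.strong_induction_on generalizing A with
  | _ n ih =>
    rcases A.eq_empty_or_nonempty with rfl | hne
    · exact ⟨id, IsMatchingMap.id, moved_id⟩
    obtain ⟨c, hc⟩ := he
    have := hne.card_pos
    obtain ⟨a, ha, b, hb, hab⟩ := Finset.one_lt_card.1 (show 1 < A.card by omega)
    have hadj := hA ha hb hab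
    have hsub : {a, b} ⊆ A := Finset.insert_subset ha (Finset.singleton_subset_iff.2 hb)
    have hcard := Finset.card_sdiff_add_card_eq_card hsub
    rw [Finset.card_pair hab] at hcard
    obtain ⟨p, hp, hpm⟩ := ih _ (by omega)
      (hA.subset (Finset.coe_subset.2 (Finset.sdiff_subset (t := {a, b}))))
      ⟨c - 1, by omega⟩ rfl
    have hms := moved_swap hab
    refine ⟨_, hp.unionMap (isMatchingMap_swap hadj)
      (by rw [hms, hpm]; exact Finset.sdiff_disjoint), ?_⟩
    rw [moved_unionMap, hpm, hms, Finset.sdiff_union_of_subset hsub]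

/-- The prism over the complete graph with `n` vertices. -/
abbrev prism (n : ℕ) : SimpleGraph (Fin n × Fin 2) :=
  boxProd (⊤ : SimpleGraph (Fin n)) (⊤ : SimpleGraph (Fin 2))

theorem prism_exists_isMatchingMap {U : Finset (Fin n × Fin 2)}
    (hU : ∀ b, Even (U.filter fun x => x.2 = b).card) :
    ∃ p, IsMatchingMap (prism n) p ∧ moved p = U := by
  have hcl : ∀ b, (prism n).IsClique (U.filter fun x => x.2 = b) := by
    intro b x hx y hy hxy
    simp only [Finset.coe_filter, Set.mem_ofPred_eq] at hx hy
    have h2 : x.2 = y.2 := hx.2.trans hy.2.symm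
    exact boxProd_adj.2 (Or.inl ⟨fun h => hxy (Prod.ext h h2), h2⟩)
  obtain ⟨p, hp, hpm⟩ := exists_isMatchingMap_of_isClique (hcl 0) (hU 0)
  obtain ⟨q, hq, hqm⟩ := exists_isMatchingMap_of_isClique (hcl 1) (hU 1)
  refine ⟨_, hp.unionMap hq ?_, ?_⟩
  · rw [hpm, hqm, Finset.disjoint_left]
    intro x hx hy
    exact absurd ((Finset.mem_filter.1 hx).2.symm.trans (Finset.mem_filter.1 hy).2) (by decide)
  · rw [moved_unionMap, hpm, hqm]
    ext x
    simp only [Finset.mem_union, Finset.mem_filter]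
    have : x.2 = 0 ∨ x.2 = 1 := by
      generalize x.2 = b; revert b; decide
    tauto

theorem prism_card_filter_snd (U : Finset (Fin n × Fin 2)) (b : Fin 2) :
    (U.filter fun x => x.2 = b).card = (Finset.univ.filter fun i => (i, b) ∈ U).card := by
  symm
  refine Finset.card_bij (fun i _ => (i, b)) ?_ ?_ ?_
  · intro i hi; simpa using hi
  · intro i _ j _ h; exact congrArg Prod.fst h
  · rintro ⟨i, c⟩ h
    obtain ⟨h, rfl⟩ := Finset.mem_filter.1 h
    exact ⟨i, by simpa using h, rfl⟩

theorem prism_card_add (U : Finset (Fin n × Fin 2)) :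
    (U.filter fun x => x.2 = 0).card + (U.filter fun x => x.2 = 1).card = U.card := by
  rw [← Finset.card_filter_add_card_filter_not (s := U) fun x => x.2 = 0]
  congr 2
  refine Finset.filter_congr fun x _ => ?_
  generalize x.2 = b
  revert b; decide

theorem prism_exists_compl {f : Fin (2 * k) × Fin 2 → Fin (2 * k) × Fin 2}
    (hf : IsMatchingMap (prism (2 * k)) f) (hfc : (moved f).card = 2 * k) :
    ∃ g, IsMatchingMap (prism (2 * k)) g ∧ moved g = (moved f)ᶜ := by
  set U := (moved f)ᶜ with hU
  have hUc : U.card = 2 * k := by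
    have := Finset.card_compl_add_card (moved f)
    rw [← hU, Fintype.card_prod, Fintype.card_fin, Fintype.card_fin] at this
    omega
  have hadd := prism_card_add U
  have h0 := prism_card_filter_snd U 0
  have h1 := prism_card_filter_snd U 1
  set A := Finset.univ.filter fun i => (i, (0 : Fin 2)) ∈ U with hA
  set B := Finset.univ.filter fun i => (i, (1 : Fin 2)) ∈ U with hB
  have hmemA : ∀ i, i ∈ A ↔ (i, (0 : Fin 2)) ∈ U := fun i => by simp [hA]
  have hmemB : ∀ i, i ∈ B ↔ (i, (1 : Fin 2)) ∈ U := fun i => by simp [hB]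
  rcases Nat.even_or_odd A.card with hev | hodd
  · refine prism_exists_isMatchingMap fun b => ?_
    have hb : b = 0 ∨ b = 1 := by revert b; decide
    rcases hb with rfl | rfl
    · rwa [h0]
    · rw [h1]
      have : Even (A.card + B.card) := by rw [← h0, ← h1, hadd, hUc]; exact even_two_mul k
      exact (Nat.even_add.1 this).1 hev
  have hmeet : ¬ Disjoint A B := by
    intro hdis
    have hAB : A ∪ B = Finset.univ := by
      rw [← Finset.card_eq_iff_eq_univ, Finset.card_union_of_disjoint hdis, Fintype.card_fin]
      omega
    refine Nat.not_even_iff_odd.2 hodd ?_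
    have hC : Even ((moved f).filter fun x => x.2 = 0).card := by
      refine hf.even_card fun x hx => ?_
      obtain ⟨hxm, hx0⟩ := Finset.mem_filter.1 hx
      refine ⟨Finset.mem_filter.2 ⟨hf.map_mem_moved hxm, ?_⟩, mem_moved.1 hxm⟩
      rcases boxProd_adj.1 (hf.adj x (mem_moved.1 hxm)) with ⟨-, h⟩ | ⟨h, h'⟩
      · rw [← h, hx0]
      · exfalso
        have hxA : x.1 ∉ A := by
          rw [hmemA, ← hx0, hU]; simpa using mem_moved.1 hxm
        have hxB : x.1 ∈ B := (Finset.mem_union.1 (hAB ▸ Finset.mem_univ x.1)).resolve_left hxA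
        have hf1 : (f x).2 = 1 := by
          have h2 : (f x).2 ≠ 0 := fun h3 => h (hx0.trans h3.symm)
          revert h2; generalize (f x).2 = b; revert b; decide
        rw [hmemB, h', ← hf1, hU, Finset.mem_compl] at hxB
        exact hxB (hf.map_mem_moved hxm)
    have := prism_card_filter_snd (moved f) 0
    rw [this] at hC
    have hcomp : (Finset.univ.filter fun i => (i, (0 : Fin 2)) ∈ moved f) = Aᶜ := by
      ext i; simp [hA, hU]
    rw [hcomp] at hC
    have hAc := Finset.card_compl_add_card A
    rw [Fintype.card_fin] at hAc
    have : Even (Aᶜ.card + A.card) := by rw [hAc]; exact even_two_mul k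
    exact (Nat.even_add.1 this).1 hC
  obtain ⟨i, hiA, hiB⟩ := Finset.not_disjoint_iff.1 hmeet
  have hiA' := (hmemA i).1 hiA
  have hiB' := (hmemB i).1 hiB
  set W := (U.erase (i, 0)).erase (i, 1) with hW
  have hodd1 : Odd B.card := by
    have : Even (A.card + B.card) := by rw [← h0, ← h1, hadd, hUc]; exact even_two_mul k
    rw [Nat.even_add] at this
    rw [← Nat.not_even_iff_odd] at hodd ⊢
    tauto
  obtain ⟨p, hp, hpm⟩ := prism_exists_isMatchingMap (U := W) (fun b => by
    rw [prism_card_filter_snd]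
    have hb : b = 0 ∨ b = 1 := by revert b; decide
    rcases hb with rfl | rfl
    · have : (Finset.univ.filter fun j => (j, (0 : Fin 2)) ∈ W) = A.erase i := by
        ext j; simp [hA, hW]
      rw [this, Finset.card_erase_of_mem hiA]
      exact hodd.tsub_odd odd_one
    · have : (Finset.univ.filter fun j => (j, (1 : Fin 2)) ∈ W) = B.erase i := by
        ext j; simp [hB, hW]
      rw [this, Finset.card_erase_of_mem hiB]
      exact hodd1.tsub_odd odd_one)
  have hadj : (prism (2 * k)).Adj (i, 0) (i, 1) := boxProd_adj.2 (Or.inr ⟨by simp, rfl⟩)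
  have hms := moved_swap hadj.ne
  refine ⟨_, hp.unionMap (isMatchingMap_swap hadj) ?_, ?_⟩
  · rw [hms, hpm, Finset.disjoint_right]
    intro z hz
    rcases Finset.mem_insert.1 hz with rfl | hz
    · simp [hW]
    · rw [Finset.mem_singleton.1 hz]; simp [hW]
  · rw [moved_unionMap, hpm, hms]
    ext z
    simp only [hW, Finset.mem_union, Finset.mem_erase, Finset.mem_insert, Finset.mem_singleton]
    constructor
    · rintro (h | rfl | rfl)
      exacts [h.2.2, hiA', hiB']
    · tauto

theorem isExtendable_prism (hk : 1 ≤ k) : IsExtendable (prism (2 * k)) k := by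
  have : Nonempty (Fin (2 * k)) := ⟨⟨0, by omega⟩⟩
  refine isExtendable_of_isMatchingMap (connected_top.boxProd connected_top) ?_
    fun f hf hfc => prism_exists_compl hf hfc
  obtain ⟨p, hp, hpm⟩ := prism_exists_isMatchingMap (n := 2 * k) (U := Finset.univ) fun b => by
    rw [prism_card_filter_snd]; simp
  obtain ⟨f, hf, -, hfc⟩ := hp.exists_trim (m := k) (by
    rw [hpm, Finset.card_univ, Fintype.card_prod, Fintype.card_fin, Fintype.card_fin]; omega)
  exact ⟨f, hf, hfc⟩

theorem ncard_neighborSet_prism (hn : 1 ≤ n) (v : Fin n × Fin 2) :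
    ((prism n).neighborSet v).ncard = n := by
  classical
  rw [Set.ncard_eq_toFinset_card', ← neighborFinset, card_neighborFinset_eq_degree,
    degree_boxProd, complete_graph_degree, complete_graph_degree, Fintype.card_fin,
    Fintype.card_fin]
  omega

theorem ncard_edgeSet_prism (hn : 1 ≤ n) : (prism n).edgeSet.ncard = n ^ 2 := by
  classical
  have hsum := (prism n).sum_degrees_eq_twice_card_edges
  have hdeg : ∀ v [Fintype ((prism n).neighborSet v)], (prism n).degree v = n := fun v => by
    intro _
    rw [← card_neighborFinset_eq_degree, neighborFinset, ← Set.ncard_eq_toFinset_card']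
    exact ncard_neighborSet_prism hn v
  simp only [hdeg] at hsum
  rw [Finset.sum_const, Finset.card_univ, Fintype.card_prod, Fintype.card_fin, Fintype.card_fin,
    smul_eq_mul] at hsum
  rw [Set.ncard_eq_toFinset_card', ← edgeFinset]
  nlinarith

theorem not_colorable_prism (hn : 3 ≤ n) : ¬ (prism n).Colorable 2 := by
  rintro ⟨c⟩
  have key : ∀ i j : Fin n, i ≠ j → c (i, 0) ≠ c (j, 0) := fun i j hij =>
    c.valid (boxProd_adj.2 (Or.inl ⟨hij, rfl⟩))
  have h1 := key ⟨0, by omega⟩ ⟨1, by omega⟩ (by simp)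
  have h2 := key ⟨1, by omega⟩ ⟨2, by omega⟩ (by simp)
  have h3 := key ⟨0, by omega⟩ ⟨2, by omega⟩ (by simp)
  omega

end Prism

theorem eps_fourK_k (k : ℕ) (hk : 2 ≤ k) :
    IsExtendable ((⊤ : SimpleGraph (Fin (2 * k))).boxProd (⊤ : SimpleGraph (Fin 2))) k ∧
    ¬ ((⊤ : SimpleGraph (Fin (2 * k))).boxProd (⊤ : SimpleGraph (Fin 2))).Colorable 2 ∧
    (∀ v, (((⊤ : SimpleGraph (Fin (2 * k))).boxProd
      (⊤ : SimpleGraph (Fin 2))).neighborSet v).ncard = 2 * k) ∧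
    Fintype.card (Fin (2 * k) × Fin 2) = 4 * k ∧
    ((⊤ : SimpleGraph (Fin (2 * k))).boxProd
      (⊤ : SimpleGraph (Fin 2))).edgeSet.ncard = 4 * k ^ 2 ∧
    (∀ (V : Type) [Fintype V] (G : SimpleGraph V), Fintype.card V = 4 * k →
      IsExtendable G k → ¬ G.Colorable 2 → 4 * k ^ 2 ≤ G.edgeSet.ncard) := by
  classical
  refine ⟨isExtendable_prism (by omega), not_colorable_prism (by omega),
    ncard_neighborSet_prism (by omega), ?_, ?_, fun V _ G hV h hcol =>
      h.four_mul_sq_le (by omega) hV hcol⟩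
  · rw [Fintype.card_prod, Fintype.card_fin, Fintype.card_fin]; omega
  · rw [ncard_edgeSet_prism (by omega)]; ring
end
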